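/- arXiv:2409.02388 — 4 statements merged into one kernel-verified Lean document; each statement's English description precedes it below -/
import Mathlib

section
/- Let p_X be the Gaussian distribution N(μ_X, σ_X²) with σ_X > 0, and let R, R_c ∈ [0,∞], P ∈ [0,∞). Then the distortion-rate-perception function with Kullback–Leibler perception measure satisfies the lower bound D(R,R_c,P|φ_KL) ≥ min over σ̂ ∈ [σ(P), σ_X] of [ σ_X² + σ̂² − 2 σ_X σ̂ √((1 − e^{−2R})(1 − e^{−2(R + R_c + P − ψ(σ̂))})) ]. -/
open MeasureTheory ProbabilityTheory Real Set
open scoped ENNReal NNReal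

noncomputable section

open Classical in
/-- Kullback-Leibler divergence of `q` from `p`, in `[0,∞]`. -/
def KLD {α : Type*} [MeasurableSpace α] (q p : Measure α) : ℝ≥0∞ :=
  if q ≪ p ∧ Integrable (fun x => Real.log (q.rnDeriv p x).toReal) q
  then ENNReal.ofReal (∫ x, Real.log (q.rnDeriv p x).toReal ∂q) else ⊤

/-- Mutual information between `f` and `g` under `μ`. -/
def mutInfo {Ω α β : Type*} [MeasurableSpace Ω] [MeasurableSpace α] [MeasurableSpace β]
    (μ : Measure Ω) (f : Ω → α) (g : Ω → β) : ℝ≥0∞ :=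
  KLD (μ.map (fun ω => (f ω, g ω))) ((μ.map f).prod (μ.map g))

/-- Squared Wasserstein-2 distance. -/
def W2sq (p q : Measure ℝ) : ℝ≥0∞ :=
  ⨅ (cpl : Measure (ℝ × ℝ)) (_ : IsProbabilityMeasure cpl) (_ : cpl.map Prod.fst = p)
    (_ : cpl.map Prod.snd = q), ∫⁻ xy, ENNReal.ofReal ((xy.1 - xy.2) ^ 2) ∂cpl

/-- `exp(-x)` for `x ∈ [0,∞]`, with `exp(-∞) = 0`. -/
def expNeg (x : ℝ≥0∞) : ℝ := if x = ⊤ then 0 else Real.exp (-x.toReal)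

/-- Feasibility predicate for the distortion-rate-perception function. -/
def DRPfeasible (pX : Measure ℝ) (φ : Measure ℝ → Measure ℝ → ℝ≥0∞) (R Rc P : ℝ≥0∞)
    (μ : Measure (ℝ × ℝ × ℝ)) : Prop :=
  ∃ hμ : IsProbabilityMeasure μ,
    μ.map (fun w => w.1) = pX ∧
    (haveI := hμ
     CondIndepFun (MeasurableSpace.comap (fun w : ℝ × ℝ × ℝ => w.2.1) inferInstance)
      ((measurable_fst.comp measurable_snd).comap_le)
      (fun w : ℝ × ℝ × ℝ => w.1) (fun w : ℝ × ℝ × ℝ => w.2.2) μ) ∧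
    mutInfo μ (fun w => w.1) (fun w => w.2.1) ≤ R ∧
    mutInfo μ (fun w => w.2.2) (fun w => w.2.1) ≤ R + Rc ∧
    φ pX (μ.map (fun w => w.2.2)) ≤ P

/-- Mean squared distortion of a joint law of `(X, U, X̂)`. -/
def distortion (μ : Measure (ℝ × ℝ × ℝ)) : ℝ≥0∞ :=
  ∫⁻ w, ENNReal.ofReal ((w.1 - w.2.2) ^ 2) ∂μ

/-- The distortion-rate-perception function `D(R, R_c, P | φ)`. -/
def DRP (pX : Measure ℝ) (φ : Measure ℝ → Measure ℝ → ℝ≥0∞) (R Rc P : ℝ≥0∞) : ℝ≥0∞ :=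
  ⨅ (μ : Measure (ℝ × ℝ × ℝ)) (_ : DRPfeasible pX φ R Rc P μ), distortion μ

/-- `D(R, R_c, ∞)`: the DRP function without perception constraint. -/
def DRPinf (pX : Measure ℝ) (R Rc : ℝ≥0∞) : ℝ≥0∞ :=
  DRP pX (fun _ _ => 0) R Rc ⊤

/-- Deterministic-decoder (entropy-constrained quantization) function `D_e(R, R_c)`,
with `H(X̂) := I(X̂; X̂)`. -/
def De (pX : Measure ℝ) (R Rc : ℝ≥0∞) : ℝ≥0∞ :=
  ⨅ (cpl : Measure (ℝ × ℝ)) (_ : IsProbabilityMeasure cpl ∧ cpl.map Prod.fst = pX ∧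
      mutInfo cpl Prod.fst Prod.snd ≤ R ∧ mutInfo cpl Prod.snd Prod.snd ≤ R + Rc),
    ∫⁻ w, ENNReal.ofReal ((w.1 - w.2) ^ 2) ∂cpl

/-- The Gaussian measure `N(μ, σ²)`. -/
def gauss (μ σ : ℝ) : Measure ℝ := gaussianReal μ ⟨σ ^ 2, sq_nonneg σ⟩

end
noncomputable section

/-- `ξ(R, R_c) = √((1 - e^{-2R})(1 - e^{-2(R+R_c)}))`. -/
def xiRRc (R Rc : ℝ≥0∞) : ℝ :=
  Real.sqrt ((1 - expNeg (2 * R)) * (1 - expNeg (2 * (R + Rc))))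

/-- `ψ(σ) = log(σ_X/σ) + (σ² - σ_X²)/(2σ_X²)`. -/
def psi (σX s : ℝ) : ℝ := Real.log (σX / s) + (s ^ 2 - σX ^ 2) / (2 * σX ^ 2)

/-- `δ₊(σ̂, α)` from the improved lower bound. -/
def deltaPlus (σX : ℝ) (R Rc : ℝ≥0∞) (P s α : ℝ) : ℝ :=
  max (σX * expNeg (R + Rc) -
    Real.sqrt (σX ^ 2 - α * (σX ^ 2 + s ^ 2 - P) + α ^ 2 * s ^ 2)) 0 / α

/-- The inner `sup` over `α > 0` in the improved lower bound `D̲'`. -/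
def DlowerPrimeFun (σX : ℝ) (R Rc : ℝ≥0∞) (P s : ℝ) : ℝ :=
  sSup ((fun α => σX ^ 2 + s ^ 2 - 2 * σX *
    Real.sqrt ((1 - expNeg (2 * R)) * (s ^ 2 - deltaPlus σX R Rc P s α ^ 2))) '' Set.Ioi 0)

/-- The improved explicit lower bound `D̲'(R, R_c, P | W₂²)`. -/
def DlowerPrime (σX : ℝ) (R Rc : ℝ≥0∞) (P : ℝ) : ℝ :=
  sInf (DlowerPrimeFun σX R Rc P '' Set.Icc (max (σX - Real.sqrt P) 0) σX)

/-- The explicit lower bound `D̲(R, R_c, P | W₂²)` of Xie et al. -/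
def DlowerW2 (σX : ℝ) (R Rc : ℝ≥0∞) (P : ℝ) : ℝ :=
  sInf ((fun s => σX ^ 2 + s ^ 2 - 2 * σX *
      Real.sqrt ((1 - expNeg (2 * R)) *
        (s ^ 2 - max (σX * expNeg (R + Rc) - Real.sqrt P) 0 ^ 2)))
    '' Set.Icc (max (σX - Real.sqrt P) 0) σX)

end


section helpers

lemma aux_inv_wd {α : Type*} [MeasurableSpace α] (ν : Measure α) (f G : α → ℝ≥0∞)
    (hf : Measurable f) (hG : Measurable G) :
    ∫⁻ x, (f x)⁻¹ * G x ∂(ν.withDensity f) ≤ ∫⁻ x, G x ∂ν := by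
  rw [lintegral_withDensity_eq_lintegral_mul _ hf (by fun_prop)]
  refine lintegral_mono fun x => ?_
  simp only [Pi.mul_apply]
  rw [← mul_assoc]
  calc _ ≤ 1 * G x := by gcongr; exact ENNReal.mul_inv_le_one _
    _ = _ := one_mul _

lemma aux_inv_rn {α : Type*} [MeasurableSpace α] (q ν : Measure α) [SigmaFinite q] [SigmaFinite ν]
    (h : q ≪ ν) (G : α → ℝ≥0∞) (hG : Measurable G) :
    ∫⁻ x, (q.rnDeriv ν x)⁻¹ * G x ∂q ≤ ∫⁻ x, G x ∂ν := by
  have := aux_inv_wd ν (q.rnDeriv ν) G (Measure.measurable_rnDeriv _ _) hG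
  rwa [Measure.withDensity_rnDeriv_eq _ _ h] at this

lemma KLD_le {α : Type*} [MeasurableSpace α] (q p : Measure α) (K : ℝ) (hK : 0 ≤ K)
    (h : KLD q p ≤ ENNReal.ofReal K) :
    q ≪ p ∧ Integrable (fun x => Real.log (q.rnDeriv p x).toReal) q ∧
      ∫ x, Real.log (q.rnDeriv p x).toReal ∂q ≤ K := by
  unfold KLD at h
  split_ifs at h with h1
  · exact ⟨h1.1, h1.2, (ENNReal.ofReal_le_ofReal_iff hK).1 h⟩
  · simp at h

lemma log_gaussianPDFReal (m : ℝ) (v : ℝ≥0) (hv : v ≠ 0) (y : ℝ) :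
    Real.log (gaussianPDFReal m v y) =
      - (1/2) * Real.log (2 * π) - (1/2) * Real.log v - (y - m)^2 / (2 * v) := by
  have hv' : (0:ℝ) < v := by positivity
  unfold gaussianPDFReal
  rw [Real.log_mul (by positivity) (by positivity), Real.log_exp, Real.log_inv, Real.log_sqrt (by positivity),
    Real.log_mul (by positivity) (by positivity)]
  ring

lemma key {Ω : Type*} [MeasurableSpace Ω] (μ : Measure Ω) [IsProbabilityMeasure μ]
    (Y U : Ω → ℝ) (hY : Measurable Y) (hU : Measurable U) (M : ℝ → ℝ) (hM : Measurable M)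
    (hY2 : MemLp Y 2 μ) (hM2 : MemLp (fun ω => M (U ω)) 2 μ)
    (m : ℝ) (w v : ℝ≥0) (hw : w ≠ 0) (hv : v ≠ 0) (I K : ℝ) (hI0 : 0 ≤ I) (hK0 : 0 ≤ K)
    (hI : mutInfo μ Y U ≤ ENNReal.ofReal I)
    (hK : KLD (μ.map Y) (gaussianReal m w) ≤ ENNReal.ofReal K) :
    0 ≤ I + K + (1/2) * Real.log v - (1/2) * Real.log w - (∫ ω, (Y ω - m)^2 ∂μ) / (2 * w)
      + (∫ ω, (Y ω - M (U ω))^2 ∂μ) / (2 * v) := by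
  have hYU : Measurable (fun ω => (Y ω, U ω)) := hY.prodMk hU
  have : IsProbabilityMeasure (μ.map Y) := Measure.isProbabilityMeasure_map hY.aemeasurable
  have : IsProbabilityMeasure (μ.map U) := Measure.isProbabilityMeasure_map hU.aemeasurable
  have : IsProbabilityMeasure (μ.map (fun ω => (Y ω, U ω))) :=
    Measure.isProbabilityMeasure_map hYU.aemeasurable
  obtain ⟨ac1, int1, le1⟩ := KLD_le _ _ _ hI0 hI
  obtain ⟨ac2, int2, le2⟩ := KLD_le _ _ _ hK0 hK
  set p := μ.map (fun ω => (Y ω, U ω)) with hp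
  set f1 := p.rnDeriv ((μ.map Y).prod (μ.map U)) with hf1
  set f2 := (μ.map Y).rnDeriv (gaussianReal m w) with hf2
  have mf1 : Measurable f1 := Measure.measurable_rnDeriv _ _
  have mf2 : Measurable f2 := Measure.measurable_rnDeriv _ _
  have mg : Measurable (gaussianPDF m w) := measurable_gaussianPDF m w
  have mh : Measurable (fun z : ℝ × ℝ => gaussianPDF (M z.2) v z.1) :=
    measurable_uncurry_gaussianPDF.comp
      ((hM.comp measurable_snd).prodMk (measurable_const.prodMk measurable_fst))
  have pfst : p.map Prod.fst = μ.map Y := by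
    rw [hp, Measure.map_map measurable_fst hYU]; rfl
  set F : ℝ × ℝ → ℝ≥0∞ := fun z => (f1 z)⁻¹ * ((f2 z.1)⁻¹ *
    ((gaussianPDF m w z.1)⁻¹ * gaussianPDF (M z.2) v z.1)) with hF
  have mF : Measurable F := by fun_prop
  have hF1 : ∫⁻ z, F z ∂p ≤ 1 := by
    calc ∫⁻ z, F z ∂p ≤ ∫⁻ z, ((f2 z.1)⁻¹ *
          ((gaussianPDF m w z.1)⁻¹ * gaussianPDF (M z.2) v z.1)) ∂((μ.map Y).prod (μ.map U)) :=
          aux_inv_rn _ _ ac1 _ (by fun_prop)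
      _ = ∫⁻ u, ∫⁻ y, ((f2 y)⁻¹ *
          ((gaussianPDF m w y)⁻¹ * gaussianPDF (M u) v y)) ∂(μ.map Y) ∂(μ.map U) := by
          rw [lintegral_prod_symm _ (by fun_prop)]
      _ ≤ ∫⁻ u, 1 ∂(μ.map U) := by
          refine lintegral_mono fun u => ?_
          have mu := measurable_gaussianPDF (M u) v
          refine (aux_inv_rn _ _ ac2 _ (by fun_prop)).trans ?_
          rw [gaussianReal_of_var_ne_zero m hw]
          refine (aux_inv_wd _ _ _ mg mu).trans ?_
          rw [lintegral_gaussianPDF_eq_one _ hv]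
      _ = 1 := by simp
  have intF : Integrable (fun z => (F z).toReal) p :=
    integrable_toReal_of_lintegral_ne_top mF.aemeasurable (hF1.trans_lt ENNReal.one_lt_top).ne
  have hF1' : ∫ z, (F z).toReal ∂p ≤ 1 := by
    rw [integral_toReal mF.aemeasurable (ae_lt_top mF (hF1.trans_lt ENNReal.one_lt_top).ne)]
    exact ENNReal.toReal_mono ENNReal.one_ne_top hF1
  have int2' : Integrable (fun z : ℝ × ℝ => Real.log (f2 z.1).toReal) p := by
    rw [← pfst] at int2
    exact (integrable_map_measure int2.1 measurable_fst.aemeasurable).1 int2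
  have eq2 : ∫ z, Real.log (f2 z.1).toReal ∂p = ∫ y, Real.log (f2 y).toReal ∂(μ.map Y) := by
    rw [← pfst, integral_map measurable_fst.aemeasurable]
    rw [pfst]; exact int2.1
  have ptop1 : ∀ᵐ z ∂p, f1 z < ⊤ := ac1.ae_le (Measure.rnDeriv_lt_top _ _)
  have ppos1 : ∀ᵐ z ∂p, 0 < f1 z := Measure.rnDeriv_pos ac1
  have ptop2 : ∀ᵐ z ∂p, f2 z.1 < ⊤ := by
    have : ∀ᵐ y ∂(p.map Prod.fst), f2 y < ⊤ := by
      rw [pfst]; exact ac2.ae_le (Measure.rnDeriv_lt_top _ _)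
    exact ae_of_ae_map measurable_fst.aemeasurable this
  have ppos2 : ∀ᵐ z ∂p, 0 < f2 z.1 := by
    have : ∀ᵐ y ∂(p.map Prod.fst), 0 < f2 y := by
      rw [pfst]; exact Measure.rnDeriv_pos ac2
    exact ae_of_ae_map measurable_fst.aemeasurable this
  have sqY : Integrable (fun ω => (Y ω - m)^2) μ := (hY2.sub (memLp_const m)).integrable_sq
  have sqM : Integrable (fun ω => (Y ω - M (U ω))^2) μ := (hY2.sub hM2).integrable_sq
  have mA : Measurable (fun z : ℝ × ℝ => (z.1 - m)^2) := by fun_prop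
  have mB : Measurable (fun z : ℝ × ℝ => (z.1 - M z.2)^2) := by fun_prop
  have intA : Integrable (fun z : ℝ × ℝ => (z.1 - m)^2) p :=
    (integrable_map_measure mA.aestronglyMeasurable hYU.aemeasurable).2 sqY
  have intB : Integrable (fun z : ℝ × ℝ => (z.1 - M z.2)^2) p :=
    (integrable_map_measure mB.aestronglyMeasurable hYU.aemeasurable).2 sqM
  have eqA : ∫ z : ℝ × ℝ, (z.1 - m)^2 ∂p = ∫ ω, (Y ω - m)^2 ∂μ :=
    integral_map hYU.aemeasurable mA.aestronglyMeasurable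
  have eqB : ∫ z : ℝ × ℝ, (z.1 - M z.2)^2 ∂p = ∫ ω, (Y ω - M (U ω))^2 ∂μ :=
    integral_map hYU.aemeasurable mB.aestronglyMeasurable
  have main : ∫ z, (1 - (F z).toReal) ∂p ≤ ∫ z, (((Real.log (f1 z).toReal + Real.log (f2 z.1).toReal)
      + ((1/2) * Real.log v - (1/2) * Real.log w)) - (z.1 - m)^2 / (2 * w)
      + (z.1 - M z.2)^2 / (2 * v)) ∂p := by
    refine integral_mono_ae ((integrable_const _).sub intF)
      ((((int1.add int2').add (integrable_const _)).sub (intA.div_const _)).add (intB.div_const _)) ?_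
    filter_upwards [ptop1, ppos1, ptop2, ppos2] with z h1 h2 h3 h4
    have a0 : 0 < (f1 z).toReal := ENNReal.toReal_pos h2.ne' h1.ne
    have b0 : 0 < (f2 z.1).toReal := ENNReal.toReal_pos h4.ne' h3.ne
    have c0 := gaussianPDFReal_pos m w z.1 hw
    have d0 := gaussianPDFReal_pos (M z.2) v z.1 hv
    have e : (F z).toReal = (f1 z).toReal⁻¹ * ((f2 z.1).toReal⁻¹ *
        ((gaussianPDFReal m w z.1)⁻¹ * gaussianPDFReal (M z.2) v z.1)) := by
      simp [hF, ENNReal.toReal_mul, ENNReal.toReal_inv, toReal_gaussianPDF]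
    have pos : 0 < (F z).toReal := by rw [e]; positivity
    have l := Real.log_le_sub_one_of_pos pos
    have l2 : Real.log (F z).toReal = - Real.log (f1 z).toReal - Real.log (f2 z.1).toReal
        - Real.log (gaussianPDFReal m w z.1) + Real.log (gaussianPDFReal (M z.2) v z.1) := by
      rw [e, Real.log_mul (by positivity) (by positivity), Real.log_mul (by positivity) (by positivity),
        Real.log_mul (by positivity) (by positivity), Real.log_inv, Real.log_inv, Real.log_inv]
      ring
    rw [l2, log_gaussianPDFReal _ _ hw, log_gaussianPDFReal _ _ hv] at l
    linarith
  have j1 : Integrable (fun z : ℝ × ℝ => Real.log (f1 z).toReal + Real.log (f2 z.1).toReal) p :=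
    int1.add int2'
  have j2 : Integrable (fun z : ℝ × ℝ => (Real.log (f1 z).toReal + Real.log (f2 z.1).toReal)
      + ((1/2) * Real.log v - (1/2) * Real.log w)) p := j1.add (integrable_const _)
  have j3 : Integrable (fun z : ℝ × ℝ => (Real.log (f1 z).toReal + Real.log (f2 z.1).toReal)
      + ((1/2) * Real.log v - (1/2) * Real.log w) - (z.1 - m)^2 / (2 * w)) p :=
    j2.sub (intA.div_const _)
  rw [integral_sub (integrable_const _) intF, integral_add j3 (intB.div_const _),
    integral_sub j2 (intA.div_const _), integral_add j1 (integrable_const _), integral_add int1 int2',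
    integral_div, integral_div, eqA, eqB, eq2] at main
  simp only [integral_const, probReal_univ, one_smul] at main
  linarith

lemma cov_condExp {Ω : Type*} [MeasurableSpace Ω] [StandardBorelSpace Ω] (μ : Measure Ω)
    [IsProbabilityMeasure μ] (X Y k : Ω → ℝ) (hX : Measurable X) (hY : Measurable Y)
    (hk : Measurable k) (hX2 : MemLp X 2 μ) (hY2 : MemLp Y 2 μ)
    (h : CondIndepFun (MeasurableSpace.comap k inferInstance) hk.comap_le X Y μ) :
    ∫ ω, X ω * Y ω ∂μ = ∫ ω, (μ[X | MeasurableSpace.comap k inferInstance]) ω *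
      (μ[Y | MeasurableSpace.comap k inferInstance]) ω ∂μ := by
  have hkY : Measurable (fun ω => (k ω, Y ω)) := hk.prodMk hY
  have hXi : Integrable X μ := hX2.integrable one_le_two
  have hYi : Integrable Y μ := hY2.integrable one_le_two
  have e1 : μ[X | (MeasurableSpace.comap (fun ω => (k ω, Y ω)) inferInstance)] =ᵐ[μ] μ[X | (MeasurableSpace.comap k inferInstance)] := by
    have a := condExp_ae_eq_integral_condDistrib' hkY hXi
    have b := condExp_ae_eq_integral_condDistrib' hk hXi
    have c := (condIndepFun_iff_condDistrib_prod_ae_eq_prodMkRight hX hY hk).1 h.symm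
    have d := ae_of_ae_map hkY.aemeasurable c
    filter_upwards [a, b, d] with ω h1 h2 h3
    rw [h1, h2, h3]
    rfl
  have hXY : Integrable (fun ω => X ω * Y ω) μ := hX2.integrable_mul hY2
  have hmX2 : MemLp (μ[X | (MeasurableSpace.comap k inferInstance)]) 2 μ := hX2.condExp one_le_two
  have hXY' : Integrable (fun ω => (μ[X | (MeasurableSpace.comap k inferInstance)]) ω * Y ω) μ := hmX2.integrable_mul hY2
  have hYm : StronglyMeasurable[(MeasurableSpace.comap (fun ω => (k ω, Y ω)) inferInstance)] Y := by
    have : Measurable[(MeasurableSpace.comap (fun ω => (k ω, Y ω)) inferInstance)] Y :=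
      measurable_snd.comp (comap_measurable (fun ω => (k ω, Y ω)))
    exact this.stronglyMeasurable
  calc ∫ ω, X ω * Y ω ∂μ = ∫ ω, (μ[(fun ω => X ω * Y ω) | (MeasurableSpace.comap (fun ω => (k ω, Y ω)) inferInstance)]) ω ∂μ :=
        (integral_condExp hkY.comap_le).symm
    _ = ∫ ω, (μ[X | (MeasurableSpace.comap (fun ω => (k ω, Y ω)) inferInstance)]) ω * Y ω ∂μ :=
        integral_congr_ae (condExp_mul_of_stronglyMeasurable_right hYm hXY hXi)
    _ = ∫ ω, (μ[X | (MeasurableSpace.comap k inferInstance)]) ω * Y ω ∂μ := by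
        refine integral_congr_ae ?_
        filter_upwards [e1] with ω h1
        rw [h1]
    _ = ∫ ω, (μ[(fun ω => (μ[X | (MeasurableSpace.comap k inferInstance)]) ω * Y ω) | (MeasurableSpace.comap k inferInstance)]) ω ∂μ :=
        (integral_condExp hk.comap_le).symm
    _ = _ :=
        integral_congr_ae (condExp_mul_of_stronglyMeasurable_left stronglyMeasurable_condExp hXY' hYi)

end helpers

section helpers2

lemma KLD_self {α : Type*} [MeasurableSpace α] (q : Measure α) [SigmaFinite q] : KLD q q = 0 := by
  have h : (fun x => Real.log (q.rnDeriv q x).toReal) =ᵐ[q] fun _ => (0:ℝ) := by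
    filter_upwards [Measure.rnDeriv_self q] with x hx
    simp [hx]
  unfold KLD
  rw [if_pos ⟨Measure.AbsolutelyContinuous.rfl, (integrable_congr h).2 (integrable_zero _ _ _)⟩,
    integral_congr_ae h]
  simp

lemma opt_v (V c : ℝ) (hV : 0 ≤ V) (h : ∀ v : ℝ, 0 < v → 0 ≤ c + (1/2) * Real.log v + V / (2 * v)) :
    Real.exp (-2 * c - 1) ≤ V := by
  rcases hV.eq_or_lt with h0 | h0
  · have := h (Real.exp (-2 * c - 1)) (Real.exp_pos _)
    rw [Real.log_exp, ← h0] at this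
    simp at this
    linarith
  · have := h V h0
    have e : V / (2 * V) = 1 / 2 := by field_simp
    rw [e] at this
    rw [← Real.le_log_iff_exp_le h0]
    linarith

lemma expNeg_nonneg (x : ℝ≥0∞) : 0 ≤ expNeg x := by
  unfold expNeg; split_ifs <;> positivity

lemma expNeg_le_one (x : ℝ≥0∞) : expNeg x ≤ 1 := by
  unfold expNeg; split_ifs
  · norm_num
  · exact Real.exp_le_one_iff.2 (by simp)

lemma var_bound {Ω : Type*} [MeasurableSpace Ω] (μ : Measure Ω) [IsProbabilityMeasure μ]
    (Y U : Ω → ℝ) (hY : Measurable Y) (hU : Measurable U) (M : ℝ → ℝ) (hM : Measurable M)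
    (hY2 : MemLp Y 2 μ) (hM2 : MemLp (fun ω => M (U ω)) 2 μ)
    (m : ℝ) (w : ℝ≥0) (hw : w ≠ 0) (I : ℝ≥0∞) (K : ℝ) (hK0 : 0 ≤ K)
    (hI : mutInfo μ Y U ≤ I)
    (hK : KLD (μ.map Y) (gaussianReal m w) ≤ ENNReal.ofReal K) :
    w * Real.exp ((∫ ω, (Y ω - m)^2 ∂μ) / w - 1 - 2 * K) * expNeg (2 * I) ≤
      ∫ ω, (Y ω - M (U ω))^2 ∂μ := by
  have hw' : (0:ℝ) < w := by positivity
  have hV : 0 ≤ ∫ ω, (Y ω - M (U ω))^2 ∂μ := integral_nonneg fun ω => sq_nonneg _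
  by_cases hT : I = ⊤
  · have : expNeg (2 * I) = 0 := by simp [expNeg, hT]
    rw [this, mul_zero]; exact hV
  have e : expNeg (2 * I) = Real.exp (- (2 * I.toReal)) := by
    unfold expNeg
    rw [if_neg (ENNReal.mul_ne_top (by simp) hT)]
    simp [ENNReal.toReal_mul]
  rw [e]
  have := opt_v _ (I.toReal + K - (1/2) * Real.log w - (∫ ω, (Y ω - m)^2 ∂μ) / (2 * w)) hV (by
    intro v hv
    have := key μ Y U hY hU M hM hY2 hM2 m w v.toNNReal hw
      (Real.toNNReal_pos.2 hv).ne' I.toReal K ENNReal.toReal_nonneg hK0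
      (by rwa [ENNReal.ofReal_toReal hT]) hK
    rw [Real.coe_toNNReal v hv.le] at this
    linarith)
  refine le_trans (le_of_eq ?_) this
  have e2 : (w:ℝ) = Real.exp (Real.log w) := (Real.exp_log hw').symm
  have e3 : (∫ ω, (Y ω - m)^2 ∂μ) / (2 * w) = (1/2) * ((∫ ω, (Y ω - m)^2 ∂μ) / w) := by
    field_simp
  rw [e3]
  nth_rewrite 1 [e2]
  rw [← Real.exp_add, ← Real.exp_add]
  congr 1
  ring

lemma mutInfo_const {Ω : Type*} [MeasurableSpace Ω] (μ : Measure Ω) [IsProbabilityMeasure μ]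
    (Y : Ω → ℝ) (hY : Measurable Y) : mutInfo μ Y (fun _ => (0:ℝ)) = 0 := by
  unfold mutInfo
  have := Measure.isProbabilityMeasure_map (μ := μ) hY.aemeasurable
  have h : (μ.map Y).prod (μ.map (fun _ => (0:ℝ))) = μ.map (fun ω => (Y ω, (0:ℝ))) := by
    rw [Measure.map_const, measure_univ, one_smul, Measure.prod_dirac,
      Measure.map_map (by fun_prop) hY]
    rfl
  rw [h]
  have : IsProbabilityMeasure (μ.map (fun ω => (Y ω, (0:ℝ)))) :=
    Measure.isProbabilityMeasure_map (by fun_prop)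
  exact KLD_self _

lemma cov_sq_le {Ω : Type*} [MeasurableSpace Ω] (μ : Measure Ω) [IsProbabilityMeasure μ]
    (X Y : Ω → ℝ) (hX : MemLp X 2 μ) (hY : MemLp Y 2 μ) :
    cov[X, Y; μ] ^ 2 ≤ Var[X; μ] * Var[Y; μ] := by
  have := discrim_le_zero (a := Var[X; μ]) (b := - 2 * cov[X, Y; μ]) (c := Var[Y; μ]) (by
    intro t
    have h1 := variance_sub (hX.const_smul t) hY
    have h2 := variance_nonneg (t • X - Y) μ
    rw [h1, variance_smul, covariance_smul_left] at h2
    linarith)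
  unfold discrim at this
  nlinarith

lemma var_le_sq {Ω : Type*} [MeasurableSpace Ω] (μ : Measure Ω) [IsProbabilityMeasure μ]
    (X : Ω → ℝ) (hX : MemLp X 2 μ) (m : ℝ) : Var[X; μ] ≤ ∫ ω, (X ω - m)^2 ∂μ := by
  have h1 := variance_sub_const hX.1 m
  have h2 := variance_eq_sub (hX.sub (memLp_const m))
  have h3 : Var[X - fun _ => m; μ] = Var[X; μ] := h1
  rw [← h3, h2]
  have : ∫ ω, (X ω - m)^2 ∂μ = ∫ ω, ((X - fun _ => m) ^ 2 : Ω → ℝ) ω ∂μ := rfl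
  rw [this]
  exact sub_le_self _ (sq_nonneg _)

lemma cond_var_bound {Ω : Type*} [MeasurableSpace Ω] (μ : Measure Ω) [IsProbabilityMeasure μ]
    (Y U : Ω → ℝ) (hY : Measurable Y) (hU : Measurable U)
    (hY2 : MemLp Y 2 μ)
    (m : ℝ) (w : ℝ≥0) (hw : w ≠ 0) (I : ℝ≥0∞) (K : ℝ) (hK0 : 0 ≤ K)
    (hI : mutInfo μ Y U ≤ I)
    (hK : KLD (μ.map Y) (gaussianReal m w) ≤ ENNReal.ofReal K) :
    w * Real.exp (Var[Y; μ] / w - 1 - 2 * K) * expNeg (2 * I) ≤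
      Var[Y; μ] - Var[μ[Y | MeasurableSpace.comap U inferInstance]; μ] := by
  have hw' : (0:ℝ) < w := by positivity
  have hm2 : MemLp (μ[Y | MeasurableSpace.comap U inferInstance]) 2 μ := hY2.condExp one_le_two
  obtain ⟨M, hM, hMe⟩ := (stronglyMeasurable_condExp (f := Y) (μ := μ)
    (m := MeasurableSpace.comap U inferInstance)).measurable.exists_eq_measurable_comp
  have tot := integral_condVar_add_variance_condExp hU.comap_le hY2
  have vb := var_bound μ Y U hY hU M hM hY2 (by
    have : (fun ω => M (U ω)) = μ[Y | MeasurableSpace.comap U inferInstance] := hMe.symm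
    rw [this]; exact hm2) m w hw I K hK0 hI hK
  have e : ∫ ω, (Y ω - M (U ω))^2 ∂μ =
      μ[Var[Y; μ | MeasurableSpace.comap U inferInstance]] := by
    unfold condVar
    rw [integral_condExp hU.comap_le, hMe]
    rfl
  rw [e] at vb
  have : w * Real.exp (Var[Y; μ] / w - 1 - 2 * K) * expNeg (2 * I) ≤
      w * Real.exp ((∫ ω, (Y ω - m)^2 ∂μ) / w - 1 - 2 * K) * expNeg (2 * I) := by
    have := expNeg_nonneg (2 * I)
    have := var_le_sq μ Y hY2 m
    gcongr
  linarith

lemma psi_nonneg (σ s : ℝ) (hσ : 0 < σ) (hs : 0 < s) : 0 ≤ psi σ s := by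
  unfold psi
  have h := Real.log_le_sub_one_of_pos (show 0 < (s / σ)^2 by positivity)
  rw [Real.log_pow, Real.log_div hs.ne' hσ.ne'] at h
  rw [Real.log_div hσ.ne' hs.ne']
  have e : (s^2 - σ^2) / (2 * σ^2) = (1/2) * ((s/σ)^2 - 1) := by field_simp
  rw [e]; push_cast at h; linarith

lemma psi_lt (σ s t : ℝ) (hs : 0 < s) (hst : s < t) (ht : t ≤ σ) : psi σ t < psi σ s := by
  unfold psi
  have ht0 : 0 < t := hs.trans hst
  have hσ : 0 < σ := ht0.trans_le ht
  have h := Real.log_lt_sub_one_of_pos (show 0 < (s / t)^2 by positivity) (by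
    have : s / t < 1 := (div_lt_one ht0).2 hst
    have : 0 < s / t := by positivity
    nlinarith)
  rw [Real.log_pow, Real.log_div hs.ne' ht0.ne'] at h
  rw [Real.log_div hσ.ne' hs.ne', Real.log_div hσ.ne' ht0.ne']
  have e : (t^2 - σ^2) / (2 * σ^2) - (s^2 - σ^2) / (2 * σ^2) = (t^2 - s^2) / (2 * σ^2) := by ring
  have e2 : (t^2 - s^2) / (2 * σ^2) ≤ (t^2 - s^2) / (2 * t^2) := by
    have : 0 ≤ t^2 - s^2 := by nlinarith
    gcongr
  have e3 : (t^2 - s^2) / (2 * t^2) = (1/2) * (1 - (s/t)^2) := by field_simp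
  push_cast at h
  linarith

lemma psi_exp (σ s P : ℝ) (hσ : 0 < σ) (hs : 0 < s) :
    σ^2 * Real.exp (s^2 / σ^2 - 1 - 2 * P) = s^2 * Real.exp (-(2 : ℝ) * (P - psi σ s)) := by
  unfold psi
  rw [Real.log_div hσ.ne' hs.ne']
  have e1 : σ^2 = Real.exp (2 * Real.log σ) := by
    rw [mul_comm, Real.exp_mul, Real.exp_log hσ]; norm_cast
  have e2 : s^2 = Real.exp (2 * Real.log s) := by
    rw [mul_comm, Real.exp_mul, Real.exp_log hs]; norm_cast
  have e : (s^2 - σ^2) / (2 * σ^2) = (1/2) * (s^2/σ^2 - 1) := by field_simp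
  rw [e]
  generalize s^2/σ^2 = r
  rw [e1, e2, ← Real.exp_add, ← Real.exp_add]
  congr 1
  ring

end helpers2

/-- Theorem 2 of Xie et al. (lower bound, KL perception measure). -/
theorem stmt0 (μX σX : ℝ) (hσX : 0 < σX) (R Rc : ℝ≥0∞) (P : ℝ) (hP : 0 ≤ P)
    (sP : ℝ) (hsP : sP ∈ Set.Icc 0 σX) (hψ : psi σX sP = P) :
    DRP (gauss μX σX) (fun p q => KLD q p) R Rc (ENNReal.ofReal P) ≥
      ENNReal.ofReal (sInf ((fun s => σX ^ 2 + s ^ 2 - 2 * σX * s *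
          Real.sqrt ((1 - expNeg (2 * R)) *
            (1 - expNeg (2 * (R + Rc)) * Real.exp (-(2 : ℝ) * (P - psi σX s)))))
        '' Set.Icc sP σX)) := by
  unfold DRP
  refine le_iInf₂ fun μ hfeas => ?_
  obtain ⟨hμ, hlaw, hci, hI1, hI2, hKL⟩ := hfeas
  by_cases hD : distortion μ = ⊤
  · rw [hD]; exact le_top
  set X : ℝ × ℝ × ℝ → ℝ := fun w => w.1 with hXdef
  set U : ℝ × ℝ × ℝ → ℝ := fun w => w.2.1 with hUdef
  set Z : ℝ × ℝ × ℝ → ℝ := fun w => w.2.2 with hZdef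
  have mX : Measurable X := by fun_prop
  have mU : Measurable U := by fun_prop
  have mZ : Measurable Z := by fun_prop
  unfold gauss at hlaw hKL
  set w : ℝ≥0 := ⟨σX ^ 2, sq_nonneg σX⟩ with hw
  have hwc : (w : ℝ) = σX ^ 2 := rfl
  have hw0 : w ≠ 0 := by
    intro h
    have : (w : ℝ) = 0 := by rw [h]; rfl
    rw [hwc] at this
    exact hσX.ne' (by simpa using this)
  have hX2 : MemLp X 2 μ := by
    have h := memLp_id_gaussianReal' (μ := μX) (v := w) 2 (by simp)
    rw [← hlaw] at h
    exact (memLp_map_measure_iff h.1 mX.aemeasurable).1 h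
  have intD : Integrable (fun ω => (X ω - Z ω)^2) μ := by
    refine ⟨by fun_prop, ?_⟩
    rw [hasFiniteIntegral_iff_ofReal (ae_of_all _ fun ω => sq_nonneg _)]
    exact lt_top_iff_ne_top.2 hD
  have hDeq : distortion μ = ENNReal.ofReal (∫ ω, (X ω - Z ω)^2 ∂μ) :=
    (ofReal_integral_eq_lintegral_ofReal intD (ae_of_all _ fun ω => sq_nonneg _)).symm
  have hXZ2 : MemLp (X - Z) 2 μ :=
    (memLp_two_iff_integrable_sq (by fun_prop)).2 intD
  have hZ2 : MemLp Z 2 μ := by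
    have := hX2.sub hXZ2
    simpa using this
  have varX : Var[X; μ] = σX ^ 2 := by
    have h := variance_id_gaussianReal (μ := μX) (v := w)
    rw [← hlaw, variance_map aemeasurable_id mX.aemeasurable] at h
    exact h
  have bX := cond_var_bound μ X U mX mU hX2 μX w hw0 R 0 le_rfl hI1 (by
    rw [hlaw, KLD_self]; exact bot_le)
  have bZ := cond_var_bound μ Z U mZ mU hZ2 μX w hw0 (R + Rc) P hP hI2 hKL
  have bZ0 := var_bound μ Z (fun _ => 0) mZ measurable_const (fun _ => ∫ ω, Z ω ∂μ) measurable_const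
    hZ2 (memLp_const _) μX w hw0 0 P hP (mutInfo_const μ Z mZ).le hKL
  rw [← variance_eq_integral mZ.aemeasurable] at bZ0
  have hA := var_le_sq μ Z hZ2 μX
  have cs := cov_sq_le μ (μ[X | MeasurableSpace.comap U inferInstance])
    (μ[Z | MeasurableSpace.comap U inferInstance]) (hX2.condExp one_le_two) (hZ2.condExp one_le_two)
  have covEq : cov[X, Z; μ] = cov[μ[X | MeasurableSpace.comap U inferInstance],
      μ[Z | MeasurableSpace.comap U inferInstance]; μ] := by
    rw [covariance_eq_sub hX2 hZ2,
      covariance_eq_sub (hX2.condExp one_le_two) (hZ2.condExp one_le_two),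
      integral_condExp mU.comap_le, integral_condExp mU.comap_le]
    congr 1
    exact cov_condExp μ X Z U mX mZ mU hX2 hZ2 hci
  have v1 := variance_nonneg (μ[X | MeasurableSpace.comap U inferInstance]) μ
  have v2 := variance_nonneg (μ[Z | MeasurableSpace.comap U inferInstance]) μ
  have hDl : σX ^ 2 + Var[Z; μ] - 2 * cov[X, Z; μ] ≤ ∫ ω, (X ω - Z ω)^2 ∂μ := by
    have h1 := variance_sub hX2 hZ2
    have h2 := var_le_sq μ (X - Z) hXZ2 0
    simp only [Pi.sub_apply, sub_zero] at h2
    rw [h1, varX] at h2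
    linarith
  rw [hDeq]
  apply ENNReal.ofReal_le_ofReal
  rw [← covEq] at cs
  generalize Var[μ[X | MeasurableSpace.comap U inferInstance]; μ] = VX at *
  generalize Var[μ[Z | MeasurableSpace.comap U inferInstance]; μ] = VZ at *
  generalize cov[X, Z; μ] = c at *
  generalize (∫ ω, (X ω - Z ω)^2 ∂μ) = D at *
  generalize (∫ ω, (Z ω - μX)^2 ∂μ) = A at *
  rw [varX, hwc] at bX
  rw [hwc] at bZ bZ0
  have hS0 : 0 < Var[Z; μ] := by
    refine lt_of_lt_of_le ?_ bZ0
    have : expNeg (2 * 0) = 1 := by simp [expNeg]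
    rw [this]; positivity
  obtain ⟨s, hs, hsv⟩ : ∃ s : ℝ, 0 < s ∧ Var[Z; μ] = s ^ 2 :=
    ⟨√Var[Z; μ], Real.sqrt_pos.2 hS0, (Real.sq_sqrt hS0.le).symm⟩
  rw [hsv] at bZ bZ0 hA hDl
  have eP : s^2 * Real.exp (-(2 : ℝ) * (P - psi σX s)) ≤ s^2 := by
    rw [← psi_exp σX s P hσX hs]
    have : expNeg (2 * 0) = 1 := by simp [expNeg]
    rw [this, mul_one] at bZ0
    refine le_trans ?_ bZ0
    gcongr
  have hψs : psi σX s ≤ P := by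
    have h1 : Real.exp (-(2 : ℝ) * (P - psi σX s)) ≤ 1 := by
      by_contra h
      push Not at h
      have : 0 < s^2 := by positivity
      nlinarith
    rw [Real.exp_le_one_iff] at h1
    linarith
  have hsP0 : 0 < sP := by
    rcases hsP.1.eq_or_lt with h | h
    · exfalso
      rw [← h] at hψ
      unfold psi at hψ
      have : (0 ^ 2 - σX ^ 2) / (2 * σX ^ 2) = -(1/2 : ℝ) := by field_simp; norm_num
      rw [this] at hψ
      simp at hψ
      linarith
    · exact h
  have hsge : sP ≤ s := by
    by_contra h
    push Not at h
    have := psi_lt σX s sP hs h hsP.2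
    linarith
  rw [psi_exp σX s P hσX hs] at bZ
  have eX : σX ^ 2 * Real.exp (σX ^ 2 / σX ^ 2 - 1 - 2 * 0) = σX ^ 2 := by
    rw [div_self (by positivity)]; simp
  rw [eX] at bX
  have ha0 := expNeg_nonneg (2 * R)
  have ha1 := expNeg_le_one (2 * R)
  have hb0 := expNeg_nonneg (2 * (R + Rc))
  have hb1 := expNeg_le_one (2 * (R + Rc))
  generalize expNeg (2 * R) = a at *
  generalize expNeg (2 * (R + Rc)) = b at *
  have sq1 : ∀ t : ℝ, √((1 - a) * (1 - b * Real.exp (-(2 : ℝ) * (P - psi σX t)))) ≤ 1 := by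
    intro t
    rw [Real.sqrt_le_one]
    have : 0 ≤ b * Real.exp (-(2 : ℝ) * (P - psi σX t)) := by positivity
    nlinarith
  have bdd : BddBelow ((fun s => σX ^ 2 + s ^ 2 - 2 * σX * s *
      Real.sqrt ((1 - a) * (1 - b * Real.exp (-(2 : ℝ) * (P - psi σX s))))) '' Set.Icc sP σX) := by
    refine ⟨0, ?_⟩
    rintro _ ⟨t, ht, rfl⟩
    have ht0 : 0 < t := hsP0.trans_le ht.1
    have := mul_le_mul_of_nonneg_left (sq1 t) (show 0 ≤ 2 * σX * t by positivity)
    simp only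
    nlinarith [sq_nonneg (σX - t)]
  have main : σX ^ 2 + s ^ 2 - 2 * σX * s *
      Real.sqrt ((1 - a) * (1 - b * Real.exp (-(2 : ℝ) * (P - psi σX s)))) ≤ D := by
    have hc : c ≤ σX * s * Real.sqrt ((1 - a) * (1 - b * Real.exp (-(2 : ℝ) * (P - psi σX s)))) := by
      have e : σX * s * Real.sqrt ((1 - a) * (1 - b * Real.exp (-(2 : ℝ) * (P - psi σX s)))) =
          Real.sqrt ((σX^2 * (1 - a)) * (s^2 * (1 - b * Real.exp (-(2 : ℝ) * (P - psi σX s))))) := by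
        rw [show (σX^2 * (1 - a)) * (s^2 * (1 - b * Real.exp (-(2 : ℝ) * (P - psi σX s)))) =
          (σX * s)^2 * ((1 - a) * (1 - b * Real.exp (-(2 : ℝ) * (P - psi σX s)))) by ring,
          Real.sqrt_mul (sq_nonneg (σX * s)), Real.sqrt_sq (by positivity)]
      rw [e]
      apply Real.le_sqrt_of_sq_le
      refine cs.trans ?_
      have h1 : VX ≤ σX^2 * (1 - a) := by linarith
      have h2 : VZ ≤ s^2 * (1 - b * Real.exp (-(2 : ℝ) * (P - psi σX s))) := by linarith
      exact mul_le_mul h1 h2 v2 (v1.trans h1)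
    linarith
  rcases le_total s σX with hle | hle
  · exact (csInf_le bdd ⟨s, ⟨hsge, hle⟩, rfl⟩).trans main
  · refine (csInf_le bdd ⟨σX, ⟨hsP.2, le_rfl⟩, rfl⟩).trans (le_trans ?_ main)
    have p0 : psi σX σX = 0 := by simp [psi, hσX.ne']
    have p1 := psi_nonneg σX s hσX hs
    have hq : √((1 - a) * (1 - b * Real.exp (-(2 : ℝ) * (P - psi σX s)))) ≤
        √((1 - a) * (1 - b * Real.exp (-(2 : ℝ) * (P - psi σX σX)))) := by
      apply Real.sqrt_le_sqrt
      have : 0 ≤ 1 - a := by linarith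
      have he : Real.exp (-(2 : ℝ) * (P - psi σX σX)) ≤ Real.exp (-(2 : ℝ) * (P - psi σX s)) := by
        apply Real.exp_le_exp.2
        linarith
      gcongr
    have hq1 := sq1 σX
    simp only
    generalize √((1 - a) * (1 - b * Real.exp (-(2 : ℝ) * (P - psi σX σX)))) = q at *
    have := mul_le_mul_of_nonneg_left hq (show 0 ≤ 2 * σX * s by positivity)
    have h3 : 0 ≤ (s - σX) * (1 - q) := mul_nonneg (by linarith) (by linarith)
    nlinarith [sq_nonneg (s - σX), mul_nonneg hσX.le h3]
end

section
/- Let p_X be the Gaussian distribution N(μ_X, σ_X²) with σ_X > 0, and let R, R_c ∈ [0,∞], P ∈ [0,∞). Then the distortion-rate-perception function with squared Wasserstein-2 perception measure satisfies the lower bound D(R,R_c,P|W₂²) ≥ min over σ̂ ∈ [max{σ_X − √P, 0}, σ_X] of [ σ_X² + σ̂² − 2 σ_X √((1 − e^{−2R})(σ̂² − (max{σ_X e^{−(R+R_c)} − √P, 0})²)) ]. -/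
open MeasureTheory ProbabilityTheory Real Set
open scoped ENNReal NNReal

lemma cs_int {Ω : Type*} [MeasurableSpace Ω] {μ : Measure Ω} {f g : Ω → ℝ}
    (hf : MemLp f 2 μ) (hg : MemLp g 2 μ) :
    (∫ x, f x * g x ∂μ) ^ 2 ≤ (∫ x, f x ^ 2 ∂μ) * ∫ x, g x ^ 2 ∂μ := by
  have hf2 := hf.integrable_sq
  have hg2 := hg.integrable_sq
  have hfg : Integrable (fun x => f x * g x) μ := hf.integrable_mul hg
  have key : ∀ t : ℝ, 0 ≤ (∫ x, f x ^ 2 ∂μ) * (t * t) + (2 * ∫ x, f x * g x ∂μ) * t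
      + ∫ x, g x ^ 2 ∂μ := by
    intro t
    have h0 : 0 ≤ ∫ x, (f x * t + g x) ^ 2 ∂μ := integral_nonneg fun x => sq_nonneg _
    have : ∫ x, (f x * t + g x) ^ 2 ∂μ
        = ∫ x, (f x ^ 2 * (t * t) + f x * g x * (2 * t)) + g x ^ 2 ∂μ := by
      congr 1; ext x; ring
    rw [this, integral_add, integral_add, integral_mul_const, integral_mul_const] at h0
    · linarith
    · exact hf2.mul_const _
    · exact hfg.mul_const _
    · exact (hf2.mul_const _).add (hfg.mul_const _)
    · exact hg2
  have := discrim_le_zero key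
  unfold discrim at this
  nlinarith

lemma mink {Ω : Type*} [MeasurableSpace Ω] {μ : Measure Ω} {f g : Ω → ℝ}
    (hf : MemLp f 2 μ) (hg : MemLp g 2 μ) :
    √(∫ x, (f x + g x) ^ 2 ∂μ) ≤ √(∫ x, f x ^ 2 ∂μ) + √(∫ x, g x ^ 2 ∂μ) := by
  have hf2 := hf.integrable_sq
  have hg2 := hg.integrable_sq
  have hfg : Integrable (fun x => f x * g x) μ := hf.integrable_mul hg
  have hA : 0 ≤ ∫ x, f x ^ 2 ∂μ := integral_nonneg fun x => sq_nonneg _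
  have hB : 0 ≤ ∫ x, g x ^ 2 ∂μ := integral_nonneg fun x => sq_nonneg _
  have e : ∫ x, (f x + g x) ^ 2 ∂μ
      = (∫ x, f x ^ 2 ∂μ) + 2 * (∫ x, f x * g x ∂μ) + ∫ x, g x ^ 2 ∂μ := by
    have : ∫ x, (f x + g x) ^ 2 ∂μ = ∫ x, (f x ^ 2 + 2 * (f x * g x)) + g x ^ 2 ∂μ := by
      congr 1; ext x; ring
    rw [this, integral_add, integral_add, integral_const_mul]
    · exact hf2
    · exact hfg.const_mul _
    · exact hf2.add (hfg.const_mul _)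
    · exact hg2
  have hC := Real.abs_le_sqrt (cs_int hf hg)
  rw [Real.sqrt_mul hA] at hC
  apply Real.sqrt_le_iff.2 ⟨by positivity, ?_⟩
  rw [e]
  have := le_abs_self (∫ x, f x * g x ∂μ)
  nlinarith [Real.sq_sqrt hA, Real.sq_sqrt hB]

lemma dv_bound {α β : Type*} [MeasurableSpace α] [MeasurableSpace β] (ρ ν : Measure α)
    [IsProbabilityMeasure ρ] [IsProbabilityMeasure ν] (hac : ρ ≪ ν)
    (hlogint : Integrable (fun x => Real.log (ρ.rnDeriv ν x).toReal) ρ)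
    (K : Kernel α β) [IsMarkovKernel K] (g : α × β → ℝ) (hg : Measurable g)
    (hgi : Integrable g (ρ ⊗ₘ K))
    (h1 : ∫⁻ z, ENNReal.ofReal (Real.exp (g z)) ∂(ν ⊗ₘ K) ≤ 1) :
    ∫ z, g z ∂(ρ ⊗ₘ K) ≤ ∫ x, Real.log (ρ.rnDeriv ν x).toReal ∂ρ := by
  set f := ρ.rnDeriv ν with hf
  have hfm : Measurable f := Measure.measurable_rnDeriv _ _
  have hmap : (ρ ⊗ₘ K).map Prod.fst = ρ := by
    have := Measure.fst_compProd ρ K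
    simpa [Measure.fst] using this
  have hpos : ∀ᵐ z ∂(ρ ⊗ₘ K), 0 < f z.1 ∧ f z.1 < ∞ := by
    have h0 : ∀ᵐ x ∂ρ, 0 < f x ∧ f x < ∞ := by
      filter_upwards [Measure.rnDeriv_pos hac, hac.ae_le (Measure.rnDeriv_lt_top ρ ν)] with x h1 h2
      exact ⟨h1, h2⟩
    rw [← hmap] at h0
    exact ae_of_ae_map measurable_fst.aemeasurable h0
  -- the quotient
  have hq : ∫⁻ z, ENNReal.ofReal (Real.exp (g z)) * (f z.1)⁻¹ ∂(ρ ⊗ₘ K) ≤ 1 := by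
    have hm : Measurable fun z : α × β => ENNReal.ofReal (Real.exp (g z)) := by fun_prop
    rw [Measure.lintegral_compProd (by fun_prop)]
    have : ∀ x, ∫⁻ y, ENNReal.ofReal (Real.exp (g (x, y))) * (f x)⁻¹ ∂(K x)
        = (∫⁻ y, ENNReal.ofReal (Real.exp (g (x, y))) ∂(K x)) * (f x)⁻¹ := by
      intro x
      rw [lintegral_mul_const]
      fun_prop
    simp only [this]
    rw [Measure.lintegral_compProd hm] at h1
    have hm2 : Measurable fun x => ∫⁻ y, ENNReal.ofReal (Real.exp (g (x, y))) ∂(K x) := by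
      exact Measurable.lintegral_kernel_prod_right' hm
    conv_lhs => rw [← Measure.withDensity_rnDeriv_eq ρ ν hac]
    rw [lintegral_withDensity_eq_lintegral_mul _ hfm (by fun_prop)]
    refine le_trans (lintegral_mono fun x => ?_) h1
    simp only [Pi.mul_apply]
    rw [mul_comm, mul_assoc, mul_comm _⁻¹]
    exact mul_le_of_le_one_right (zero_le) (ENNReal.mul_inv_le_one _)
  have hqae : ∀ᵐ z ∂(ρ ⊗ₘ K), ENNReal.ofReal (Real.exp (g z)) * (f z.1)⁻¹
      = ENNReal.ofReal (Real.exp (g z) / (f z.1).toReal) := by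
    filter_upwards [hpos] with z hz
    rw [ENNReal.ofReal_div_of_pos (ENNReal.toReal_pos hz.1.ne' hz.2.ne),
      ENNReal.ofReal_toReal hz.2.ne, div_eq_mul_inv]
  rw [lintegral_congr_ae hqae] at hq
  have hqm : Measurable fun z : α × β => Real.exp (g z) / (f z.1).toReal := by fun_prop
  have hqi : Integrable (fun z : α × β => Real.exp (g z) / (f z.1).toReal) (ρ ⊗ₘ K) := by
    refine ⟨hqm.aestronglyMeasurable, ?_⟩
    rw [hasFiniteIntegral_iff_ofReal (ae_of_all _ fun z => by positivity)]
    exact hq.trans_lt ENNReal.one_lt_top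
  have hqint : ∫ z, Real.exp (g z) / (f z.1).toReal ∂(ρ ⊗ₘ K) ≤ 1 := by
    rw [integral_eq_lintegral_of_nonneg_ae (ae_of_all _ fun z => by positivity)
      hqm.aestronglyMeasurable]
    exact ENNReal.toReal_le_of_le_ofReal zero_le_one (by simpa using hq)
  have hli : Integrable (fun z : α × β => Real.log (f z.1).toReal) (ρ ⊗ₘ K) := by
    rw [← hmap] at hlogint
    exact hlogint.comp_measurable measurable_fst
  have hle : ∫ z, (g z - Real.log (f z.1).toReal) ∂(ρ ⊗ₘ K)
      ≤ ∫ z, (Real.exp (g z) / (f z.1).toReal - 1) ∂(ρ ⊗ₘ K) := by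
    apply integral_mono_ae (hgi.sub hli) (hqi.sub (integrable_const _))
    filter_upwards [hpos] with z hz
    have hp := ENNReal.toReal_pos hz.1.ne' hz.2.ne
    have := Real.add_one_le_exp (g z - Real.log (f z.1).toReal)
    rw [Real.exp_sub, Real.exp_log hp] at this
    simp only [Pi.sub_apply]
    linarith
  rw [integral_sub hgi hli, integral_sub hqi (integrable_const _)] at hle
  have e : ∫ x, Real.log (f x).toReal ∂ρ = ∫ z, Real.log (f z.1).toReal ∂(ρ ⊗ₘ K) := by
    conv_lhs => rw [← hmap]
    rw [integral_map measurable_fst.aemeasurable]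
    exact (by fun_prop : Measurable fun x => Real.log (f x).toReal).aestronglyMeasurable
  rw [e]
  simp at hle
  linarith

lemma gauss_eq (m σ : ℝ) : gauss m σ = gaussianReal m (σ ^ 2).toNNReal := by
  unfold gauss
  congr 1
  apply NNReal.eq
  rw [Real.coe_toNNReal _ (sq_nonneg σ)]
  rfl

lemma gauss_tilt (m σ c d : ℝ) (hσ : 0 < σ) (hd : 0 < d) :
    ∫⁻ x, ENNReal.ofReal (Real.exp (Real.log (σ / d) + (x - m) ^ 2 / (2 * σ ^ 2)
      - (x - c) ^ 2 / (2 * d ^ 2))) ∂(gauss m σ) = 1 := by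
  have hv : (σ ^ 2).toNNReal ≠ 0 := by simp; positivity
  have hv' : (d ^ 2).toNNReal ≠ 0 := by simp; positivity
  rw [gauss_eq, gaussianReal_of_var_ne_zero _ hv,
    lintegral_withDensity_eq_lintegral_mul _ (measurable_gaussianPDF _ _) (by fun_prop),
    ← lintegral_gaussianPDF_eq_one c hv']
  refine lintegral_congr fun x => ?_
  simp only [Pi.mul_apply, gaussianPDF]
  rw [← ENNReal.ofReal_mul (gaussianPDFReal_nonneg _ _ _)]
  congr 1
  simp only [gaussianPDFReal, Real.coe_toNNReal _ (sq_nonneg _)]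
  rw [Real.sqrt_mul (x := 2 * π) (by positivity), Real.sqrt_mul (x := 2 * π) (by positivity), Real.sqrt_sq hσ.le,
    Real.sqrt_sq hd.le, add_sub_assoc, Real.exp_add, Real.exp_log (by positivity)]
  have : Real.exp (-(x - c) ^ 2 / (2 * d ^ 2)) = Real.exp (-(x - m) ^ 2 / (2 * σ ^ 2)) *
      Real.exp ((x - m) ^ 2 / (2 * σ ^ 2) - (x - c) ^ 2 / (2 * d ^ 2)) := by
    rw [← Real.exp_add]; congr 1; ring
  rw [this]
  field_simp

lemma glue_map (γ : Measure (ℝ × ℝ)) [IsProbabilityMeasure γ] (τ : Measure (ℝ × ℝ))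
    [IsProbabilityMeasure τ] (h : τ.map Prod.fst = γ.map Prod.fst) :
    (τ ⊗ₘ (γ.condKernel.comap Prod.fst measurable_fst)).map
      (fun z : (ℝ × ℝ) × ℝ => (z.1.1, z.2)) = γ := by
  apply Measure.ext_of_lintegral
  intro f hf
  rw [lintegral_map hf (by fun_prop), Measure.lintegral_compProd (by fun_prop)]
  simp only [Kernel.comap_apply]
  have h2 := lintegral_map (μ := τ) (g := Prod.fst)
    (f := fun y => ∫⁻ x, f (y, x) ∂(γ.condKernel y)) hf.lintegral_kernel_prod_right'
    measurable_fst
  rw [← h2, h]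
  conv_rhs => rw [← γ.disintegrate γ.condKernel]
  rw [Measure.lintegral_compProd hf]
  rfl

lemma memLp_gauss (m σ : ℝ) : MemLp id 2 (gauss m σ) := by
  rw [gauss_eq]; exact memLp_id_gaussianReal 2

lemma var_gauss (m σ : ℝ) : ∫ x, (x - m) ^ 2 ∂(gauss m σ) = σ ^ 2 := by
  have h := variance_id_gaussianReal (μ := m) (v := (σ ^ 2).toNNReal)
  rw [variance_eq_integral (by fun_prop)] at h
  rw [gauss_eq]
  simpa [integral_id_gaussianReal, Real.coe_toNNReal _ (sq_nonneg σ)] using h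

instance (m σ : ℝ) : IsProbabilityMeasure (gauss m σ) := by rw [gauss_eq]; infer_instance

/-- `γ` is a coupling of `Y` (first) and a Gaussian `G` (second), `ρ` the law of `(Y, U)`. -/
lemma core (m σ : ℝ) (hσ : 0 < σ) (γ ρ : Measure (ℝ × ℝ)) [IsProbabilityMeasure γ]
    [IsProbabilityMeasure ρ] (hγ2 : γ.map Prod.snd = gauss m σ)
    (hγ1 : ρ.map Prod.fst = γ.map Prod.fst) (h : ℝ → ℝ) (hm : Measurable h)
    (hγ : MemLp (fun z : ℝ × ℝ => z.2 - z.1) 2 γ) (hh : MemLp (fun z : ℝ × ℝ => z.1 - h z.2) 2 ρ)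
    (T : ℝ≥0∞) (hT : KLD ρ ((ρ.map Prod.fst).prod (ρ.map Prod.snd)) ≤ T) :
    σ * expNeg T ≤ √(∫ z, (z.2 - z.1) ^ 2 ∂γ) + √(∫ z, (z.1 - h z.2) ^ 2 ∂ρ) := by
  by_cases hTt : T = ⊤
  · simp [expNeg, hTt]; positivity
  unfold KLD at hT
  split_ifs at hT with hc
  swap
  · exact absurd (top_le_iff.1 hT) hTt
  obtain ⟨hac, hlogint⟩ := hc
  have : IsProbabilityMeasure (ρ.map Prod.fst) :=
    Measure.isProbabilityMeasure_map measurable_fst.aemeasurable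
  have : IsProbabilityMeasure (ρ.map Prod.snd) :=
    Measure.isProbabilityMeasure_map measurable_snd.aemeasurable
  set ν := (ρ.map Prod.fst).prod (ρ.map Prod.snd) with hν
  have hT' : ∫ x, Real.log (ρ.rnDeriv ν x).toReal ∂ρ ≤ T.toReal :=
    (ENNReal.ofReal_le_iff_le_toReal hTt).1 hT
  set K := γ.condKernel.comap Prod.fst (measurable_fst (α := ℝ) (β := ℝ)) with hK
  set M := ρ ⊗ₘ K with hM
  have hMγ : M.map (fun z : (ℝ × ℝ) × ℝ => (z.1.1, z.2)) = γ := glue_map γ ρ hγ1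
  have hMρ : M.map Prod.fst = ρ := Measure.fst_compProd ρ K
  have mA : MemLp (fun z : (ℝ × ℝ) × ℝ => z.2 - z.1.1) 2 M := by
    rw [← hMγ] at hγ
    exact hγ.comp_of_map (by fun_prop)
  have mB : MemLp (fun z : (ℝ × ℝ) × ℝ => z.1.1 - h z.1.2) 2 M := by
    rw [← hMρ] at hh
    exact hh.comp_of_map (by fun_prop)
  have hMG : M.map (fun z : (ℝ × ℝ) × ℝ => z.2) = gauss m σ := by
    rw [← hγ2, ← hMγ, Measure.map_map (by fun_prop) (by fun_prop)]; rfl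
  have mG : MemLp (fun z : (ℝ × ℝ) × ℝ => z.2 - m) 2 M := by
    have := (memLp_gauss m σ).sub (memLp_const m)
    rw [← hMG] at this
    exact this.comp_of_map (by fun_prop)
  have eA : ∫ z, (z.2 - z.1) ^ 2 ∂γ = ∫ z, (z.2 - z.1.1) ^ 2 ∂M := by
    rw [← hMγ, integral_map (by fun_prop)]
    exact (by fun_prop : Measurable fun z : ℝ × ℝ => (z.2 - z.1) ^ 2).aestronglyMeasurable
  have eB : ∫ z, (z.1 - h z.2) ^ 2 ∂ρ = ∫ z, (z.1.1 - h z.1.2) ^ 2 ∂M := by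
    conv_lhs => rw [← hMρ]
    rw [integral_map (by fun_prop)]
    exact (by fun_prop : Measurable fun z : ℝ × ℝ => (z.1 - h z.2) ^ 2).aestronglyMeasurable
  have eG : ∫ z, (z.2 - m) ^ 2 ∂M = σ ^ 2 := by
    rw [← var_gauss m σ, ← hMG, integral_map (by fun_prop)]
    exact (by fun_prop : Measurable fun z : ℝ => (z - m) ^ 2).aestronglyMeasurable
  have mk := mink mA mB
  rw [← eA, ← eB] at mk
  simp only [sub_add_sub_cancel] at mk
  have mC : MemLp (fun z : (ℝ × ℝ) × ℝ => z.2 - h z.1.2) 2 M := by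
    have := mA.add mB
    refine this.ae_eq (ae_of_all _ fun z => ?_)
    simp
  refine le_trans ?_ mk
  refine le_of_forall_gt_imp_ge_of_dense fun d hd => ?_
  have hd0 : 0 < d := lt_of_le_of_lt (Real.sqrt_nonneg _) hd
  have hCd : ∫ z, (z.2 - h z.1.2) ^ 2 ∂M ≤ d ^ 2 := by
    rw [← Real.sqrt_le_left hd0.le]; exact hd.le
  set g : (ℝ × ℝ) × ℝ → ℝ := fun z => Real.log (σ / d) + (z.2 - m) ^ 2 / (2 * σ ^ 2)
      - (z.2 - h z.1.2) ^ 2 / (2 * d ^ 2) with hg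
  have hgm : Measurable g := by fun_prop
  have i1 := mG.integrable_sq.div_const (2 * σ ^ 2)
  have i2 := mC.integrable_sq.div_const (2 * d ^ 2)
  have hgi : Integrable g M := ((integrable_const _).add i1).sub i2
  have h1 : ∫⁻ z, ENNReal.ofReal (Real.exp (g z)) ∂(ν ⊗ₘ K) ≤ 1 := by
    have hgm' : Measurable fun z => ENNReal.ofReal (Real.exp (g z)) := by fun_prop
    rw [Measure.lintegral_compProd hgm', hν, lintegral_prod_symm' _
      hgm'.lintegral_kernel_prod_right']
    calc _ = ∫⁻ y, 1 ∂(ρ.map Prod.snd) := by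
          refine lintegral_congr fun u => ?_
          simp only [hg, hK, Kernel.comap_apply]
          have e1 := gauss_tilt m σ (h u) d hσ hd0
          rw [← hγ2, lintegral_map (by fun_prop) (by fun_prop)] at e1
          rw [← γ.disintegrate γ.condKernel, Measure.lintegral_compProd (by fun_prop)] at e1
          rw [hγ1]
          exact e1
      _ ≤ 1 := by simp
  have hdv := dv_bound ρ ν hac hlogint K g hgm hgi h1
  have hgval : ∫ z, g z ∂M = Real.log (σ / d) + σ ^ 2 / (2 * σ ^ 2)
      - (∫ z, (z.2 - h z.1.2) ^ 2 ∂M) / (2 * d ^ 2) := by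
    simp only [hg]
    rw [integral_sub (f := fun z : (ℝ × ℝ) × ℝ => Real.log (σ / d) + (z.2 - m) ^ 2 / (2 * σ ^ 2))
      ((integrable_const _).add i1) i2, integral_add (integrable_const _) i1,
      integral_div, integral_div, eG]
    simp
  have hlog : Real.log (σ / d) ≤ T.toReal := by
    have e1 : σ ^ 2 / (2 * σ ^ 2) = 1 / 2 := by field_simp
    have e2 : (∫ z, (z.2 - h z.1.2) ^ 2 ∂M) / (2 * d ^ 2) ≤ 1 / 2 := by
      rw [div_le_iff₀ (by positivity)]; linarith
    rw [← hM, hgval] at hdv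
    linarith
  rw [Real.log_le_iff_le_exp (by positivity), div_le_iff₀ hd0] at hlog
  simp only [expNeg, hTt, if_false, Real.exp_neg]
  rw [← div_eq_mul_inv, div_le_iff₀ (Real.exp_pos _)]
  linarith

lemma integral_mul_of_condIndep {Ω : Type*} {m' : MeasurableSpace Ω} [mΩ : MeasurableSpace Ω]
    [StandardBorelSpace Ω] (hm' : m' ≤ mΩ) (μ : Measure Ω) [IsFiniteMeasure μ] {f g : Ω → ℝ}
    (hf : Measurable f) (hg : Measurable g) (hf2 : MemLp f 2 μ) (hg2 : MemLp g 2 μ)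
    (h : CondIndepFun m' hm' f g μ) :
    ∫ x, f x * g x ∂μ = ∫ x, (μ[f|m']) x * (μ[g|m']) x ∂μ := by
  have hfg : Integrable (fun x => f x * g x) μ := hf2.integrable_mul hg2
  rw [← integral_condExp hm']
  have h1 := condExp_ae_eq_integral_condExpKernel hm' hfg
  have h2 := condExp_ae_eq_integral_condExpKernel hm' (hf2.integrable one_le_two)
  have h3 := condExp_ae_eq_integral_condExpKernel hm' (hg2.integrable one_le_two)
  have h4 := ae_of_ae_trim hm' ((condIndepFun_iff_map_prod_eq_prod_map_map hf hg).1 h)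
  apply integral_congr_ae
  filter_upwards [h1, h2, h3, h4] with ω e1 e2 e3 e4
  rw [e1, e2, e3]
  rw [Kernel.map_apply _ (by fun_prop), Kernel.prod_apply, Kernel.map_apply _ hf,
    Kernel.map_apply _ hg] at e4
  have e5 : ∫ y, f y * g y ∂(condExpKernel μ m' ω)
      = ∫ p : ℝ × ℝ, p.1 * p.2 ∂((condExpKernel μ m' ω).map fun y => (f y, g y)) := by
    rw [integral_map (by fun_prop) (by fun_prop)]
  rw [e5, e4, integral_prod_mul (fun x : ℝ => x) (fun x : ℝ => x),
    integral_map (by fun_prop) (by fun_prop), integral_map (by fun_prop) (by fun_prop)]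

lemma expNeg_two_mul (x : ℝ≥0∞) : expNeg (2 * x) = expNeg x ^ 2 := by
  unfold expNeg
  by_cases h : x = ⊤
  · simp [h, ENNReal.mul_top]
  · have : 2 * x ≠ ⊤ := ENNReal.mul_ne_top (by simp) h
    simp only [h, this, if_false]
    rw [← Real.exp_nat_mul, ENNReal.toReal_mul]
    congr 1
    simp

lemma expNeg_anti {x y : ℝ≥0∞} (h : x ≤ y) : expNeg y ≤ expNeg x := by
  by_cases hy : y = ⊤
  · simpa [expNeg, hy] using expNeg_nonneg x
  · have hx : x ≠ ⊤ := ne_top_of_le_ne_top hy h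
    simp only [expNeg, hx, hy, if_false]
    have := ENNReal.toReal_mono hy h
    exact Real.exp_le_exp.2 (by linarith)

lemma w2_coupling (p q : Measure ℝ) (P c : ℝ) (hP : 0 ≤ P) (h : W2sq p q ≤ ENNReal.ofReal P)
    (hc : √P < c) : ∃ γ : Measure (ℝ × ℝ), IsProbabilityMeasure γ ∧ γ.map Prod.fst = q ∧
      γ.map Prod.snd = p ∧ MemLp (fun z : ℝ × ℝ => z.2 - z.1) 2 γ ∧
      √(∫ z, (z.2 - z.1) ^ 2 ∂γ) ≤ c := by
  have hc0 : 0 < c := lt_of_le_of_lt (Real.sqrt_nonneg _) hc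
  have h1 : W2sq p q < ENNReal.ofReal (c ^ 2) := by
    refine h.trans_lt ((ENNReal.ofReal_lt_ofReal_iff (by positivity)).2 ?_)
    exact (Real.sqrt_lt' hc0).1 hc
  unfold W2sq at h1
  simp only [iInf_lt_iff] at h1
  obtain ⟨cpl, hpr, hfst, hsnd, hlt⟩ := h1
  have hle : ∫⁻ z, ENNReal.ofReal ((z.2 - z.1) ^ 2) ∂(cpl.map Prod.swap)
      < ENNReal.ofReal (c ^ 2) := by
    rw [lintegral_map (by fun_prop) measurable_swap]
    exact hlt
  have hmeas : Measurable fun z : ℝ × ℝ => z.2 - z.1 := by fun_prop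
  refine ⟨cpl.map Prod.swap, Measure.isProbabilityMeasure_map measurable_swap.aemeasurable,
    ?_, ?_, ?_, ?_⟩
  · rw [Measure.map_map measurable_fst measurable_swap]; exact hsnd
  · rw [Measure.map_map measurable_snd measurable_swap]; exact hfst
  · rw [memLp_two_iff_integrable_sq hmeas.aestronglyMeasurable]
    refine ⟨(hmeas.pow_const 2).aestronglyMeasurable, ?_⟩
    rw [hasFiniteIntegral_iff_ofReal (ae_of_all _ fun z => sq_nonneg _)]
    exact hle.trans ENNReal.ofReal_lt_top
  · apply Real.sqrt_le_iff.2 ⟨hc0.le, ?_⟩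
    rw [integral_eq_lintegral_of_nonneg_ae (ae_of_all _ fun z => sq_nonneg _)
      (hmeas.pow_const 2).aestronglyMeasurable]
    exact ENNReal.toReal_le_of_le_ofReal (by positivity) hle.le

lemma final_analytic (σ : ℝ) (hσ : 0 < σ) (e E P s D : ℝ) (he0 : 0 ≤ e) (he1 : e ≤ 1) (hE0 : 0 ≤ E)
    (hE : E ^ 2 ≤ e) (hs0 : 0 ≤ s) (hs : σ - √P ≤ s)
    (hD : σ ^ 2 + s ^ 2 - 2 * σ * √((1 - e) * (s ^ 2 - max (σ * E - √P) 0 ^ 2)) ≤ D) :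
    sInf ((fun s => σ ^ 2 + s ^ 2 - 2 * σ *
          Real.sqrt ((1 - e) * (s ^ 2 - max (σ * E - Real.sqrt P) 0 ^ 2)))
        '' Set.Icc (max (σ - Real.sqrt P) 0) σ) ≤ D := by
  set δ := max (σ * E - √P) 0 with hδ
  have hsP := Real.sqrt_nonneg P
  have hδ0 : 0 ≤ δ := le_max_right _ _
  have hδ1 : δ ≤ σ * E := by
    apply max_le _ (by positivity); linarith
  have hbdd : BddBelow ((fun s => σ ^ 2 + s ^ 2 - 2 * σ * √((1 - e) * (s ^ 2 - δ ^ 2)))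
        '' Set.Icc (max (σ - √P) 0) σ) := by
    refine ⟨0, ?_⟩
    rintro _ ⟨t, ⟨ht, -⟩, rfl⟩
    have ht0 : 0 ≤ t := le_trans (le_max_right _ _) ht
    have : √((1 - e) * (t ^ 2 - δ ^ 2)) ≤ t := by
      apply Real.sqrt_le_iff.2 ⟨ht0, ?_⟩
      nlinarith [sq_nonneg t, sq_nonneg δ, mul_nonneg he0 (sq_nonneg t),
        mul_nonneg (sub_nonneg.2 he1) (sq_nonneg δ)]
    simp only
    nlinarith [sq_nonneg (σ - t)]
  by_cases hle : s ≤ σ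
  · exact (csInf_le hbdd ⟨s, ⟨max_le hs hs0, hle⟩, rfl⟩).trans hD
  · push Not at hle
    refine (csInf_le hbdd ⟨σ, ⟨max_le (by linarith) hσ.le, le_rfl⟩, rfl⟩).trans (le_trans ?_ hD)
    simp only
    have hδ2 : δ ^ 2 ≤ σ ^ 2 * e := by
      calc δ ^ 2 ≤ (σ * E) ^ 2 := by gcongr
        _ ≤ σ ^ 2 * e := by rw [mul_pow]; gcongr
    have h1e : 0 ≤ 1 - e := by linarith
    rw [Real.sqrt_mul h1e, Real.sqrt_mul h1e]
    have q0 : 0 ≤ σ ^ 2 - δ ^ 2 := by nlinarith [sq_nonneg σ]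
    have q1 : 0 ≤ s ^ 2 - δ ^ 2 := by nlinarith [sq_nonneg σ]
    set a := √(1 - e)
    set t0 := √(σ ^ 2 - δ ^ 2) with ht0
    set t := √(s ^ 2 - δ ^ 2) with ht
    have r0 : t0 ^ 2 = σ ^ 2 - δ ^ 2 := Real.sq_sqrt q0
    have r1 : t ^ 2 = s ^ 2 - δ ^ 2 := Real.sq_sqrt q1
    have r2 : a ^ 2 = 1 - e := Real.sq_sqrt h1e
    have m1 : t0 ≤ t := Real.sqrt_le_sqrt (by nlinarith)
    have m2 : σ * a ≤ t0 := by
      apply Real.le_sqrt_of_sq_le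
      rw [mul_pow, r2]; nlinarith
    nlinarith [mul_nonneg (sub_nonneg.2 m1) (sub_nonneg.2 m2), mul_nonneg (sub_nonneg.2 m1) (sub_nonneg.2 (m2.trans m1))]

/-- Application of `core` to a variable `Y` and its conditional expectation given `U`. -/
lemma core_condExp {Ω : Type*} [MeasurableSpace Ω] (μ : Measure Ω) [IsProbabilityMeasure μ]
    (Y U : Ω → ℝ) (hY : Measurable Y) (hU : Measurable U) (hY2 : MemLp Y 2 μ)
    (m σ : ℝ) (hσ : 0 < σ) (γ : Measure (ℝ × ℝ)) [IsProbabilityMeasure γ]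
    (hγ2 : γ.map Prod.snd = gauss m σ)
    (hγ1 : γ.map Prod.fst = μ.map Y)
    (hγ : MemLp (fun z : ℝ × ℝ => z.2 - z.1) 2 γ)
    (T : ℝ≥0∞) (hT : mutInfo μ Y U ≤ T) :
    σ * expNeg T ≤ √(∫ z, (z.2 - z.1) ^ 2 ∂γ)
      + √(∫ w, (Y w - (μ[Y|MeasurableSpace.comap U inferInstance]) w) ^ 2 ∂μ) := by
  obtain ⟨h, hm, hh⟩ := (stronglyMeasurable_condExp (f := Y) (μ := μ)
    (m := MeasurableSpace.comap U inferInstance)).exists_eq_measurable_comp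
  have hm := hm.measurable
  have mp : Measurable fun w => (Y w, U w) := hY.prodMk hU
  set ρ := μ.map (fun w => (Y w, U w)) with hρ
  have : IsProbabilityMeasure ρ := Measure.isProbabilityMeasure_map mp.aemeasurable
  have r1 : ρ.map Prod.fst = μ.map Y := by
    rw [hρ, Measure.map_map measurable_fst mp]; rfl
  have r2 : ρ.map Prod.snd = μ.map U := by
    rw [hρ, Measure.map_map measurable_snd mp]; rfl
  have hmm : Measurable fun z : ℝ × ℝ => z.1 - h z.2 := by fun_prop
  have hL : MemLp (fun z : ℝ × ℝ => z.1 - h z.2) 2 ρ := by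
    rw [hρ, memLp_map_measure_iff hmm.aestronglyMeasurable mp.aemeasurable]
    have := hY2.sub (hY2.condExp (m := MeasurableSpace.comap U inferInstance) one_le_two)
    rw [hh] at this
    exact this
  have := core m σ hσ γ ρ hγ2 (r1.trans hγ1.symm) h hm hγ hL T (by rw [r1, r2]; exact hT)
  rw [hh]
  rw [hρ, integral_map mp.aemeasurable (hmm.pow_const 2).aestronglyMeasurable] at this
  exact this

lemma total_var {Ω : Type*} {m' : MeasurableSpace Ω} [mΩ : MeasurableSpace Ω] (hm' : m' ≤ mΩ)
    (μ : Measure Ω) [IsProbabilityMeasure μ]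
    (Y : Ω → ℝ) (hY2 : MemLp Y 2 μ) :
    ∫ w, (Y w - (μ[Y|m']) w) ^ 2 ∂μ + Var[μ[Y|m']; μ] = Var[Y; μ] := by
  rw [← integral_condVar_add_variance_condExp hm' hY2, condVar, integral_condExp hm']
  rfl

lemma bound_feasible (μX σX : ℝ) (hσX : 0 < σX) (R Rc : ℝ≥0∞) (P : ℝ) (hP : 0 ≤ P)
    (μ : Measure (ℝ × ℝ × ℝ)) (hμ : DRPfeasible (gauss μX σX) W2sq R Rc (ENNReal.ofReal P) μ) :
    ENNReal.ofReal (sInf ((fun s => σX ^ 2 + s ^ 2 - 2 * σX *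
          Real.sqrt ((1 - expNeg (2 * R)) *
            (s ^ 2 - max (σX * expNeg (R + Rc) - Real.sqrt P) 0 ^ 2)))
        '' Set.Icc (max (σX - Real.sqrt P) 0) σX)) ≤ distortion μ := by
  obtain ⟨hpr, hX, hci, hI1, hI2, hW⟩ := hμ
  set X : ℝ × ℝ × ℝ → ℝ := fun w => w.1 with hXdef
  set U : ℝ × ℝ × ℝ → ℝ := fun w => w.2.1 with hUdef
  set Y : ℝ × ℝ × ℝ → ℝ := fun w => w.2.2 with hYdef
  have mX : Measurable X := by fun_prop
  have mU : Measurable U := by fun_prop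
  have mY : Measurable Y := by fun_prop
  have lX : MemLp X 2 μ := by
    have := memLp_gauss μX σX
    rw [← hX] at this
    exact this.comp_of_map mX.aemeasurable
  have lY : MemLp Y 2 μ := by
    obtain ⟨γ, hγp, h1, h2, h3, -⟩ := w2_coupling _ _ P (√P + 1) hP hW (by linarith)
    have g2 : MemLp (fun z : ℝ × ℝ => z.2) 2 γ := by
      have := memLp_gauss μX σX
      rw [← h2] at this
      exact this.comp_of_map measurable_snd.aemeasurable
    have g1 : MemLp (fun z : ℝ × ℝ => z.1) 2 γ := by
      refine (g2.sub h3).ae_eq (ae_of_all _ fun z => ?_)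
      simp
    have : MemLp id 2 (μ.map Y) := by
      rw [← h1, memLp_map_measure_iff (by fun_prop) (by fun_prop)]
      exact g1
    exact this.comp_of_map mY.aemeasurable
  have vX : Var[X; μ] = σX ^ 2 := by
    have h := variance_id_gaussianReal (μ := μX) (v := (σX ^ 2).toNNReal)
    rw [← gauss_eq, ← hX, Real.coe_toNNReal _ (sq_nonneg σX), variance_id_map mX.aemeasurable] at h
    exact h
  set s := √(Var[Y; μ]) with hs
  have hs2 : s ^ 2 = Var[Y; μ] := Real.sq_sqrt (variance_nonneg _ _)
  have hs0 : 0 ≤ s := Real.sqrt_nonneg _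
  -- lower bound for `s`
  have hsl : σX - √P ≤ s := by
    rw [sub_le_iff_le_add']
    refine le_of_forall_pos_le_add fun ε hε => ?_
    obtain ⟨γ, hγp, h1, h2, h3, h4⟩ := w2_coupling _ _ P (√P + ε) hP hW (by linarith)
    have g1 : MemLp (fun z : ℝ × ℝ => z.1) 2 γ := by
      have : MemLp id 2 (μ.map Y) := by
        rw [memLp_map_measure_iff (by fun_prop) (by fun_prop)]
        exact lY
      rw [← h1] at this
      exact this.comp_of_map measurable_fst.aemeasurable
    have g2 : MemLp (fun z : ℝ × ℝ => z.2) 2 γ := by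
      refine (g1.add h3).ae_eq (ae_of_all _ fun z => ?_)
      simp
    have hmk := mink (f := fun z : ℝ × ℝ => (z.2 - z.1) - γ[fun z => z.2 - z.1])
      (g := fun z : ℝ × ℝ => z.1 - γ[fun z => z.1])
      (h3.sub (memLp_const _)) (g1.sub (memLp_const _))
    have e0 : γ[fun z : ℝ × ℝ => z.2 - z.1] = γ[fun z => z.2] - γ[fun z => z.1] :=
      integral_sub (g2.integrable one_le_two) (g1.integrable one_le_two)
    have e1 : ∫ z, (((z.2 - z.1) - γ[fun z : ℝ × ℝ => z.2 - z.1]) + (z.1 - γ[fun z => z.1])) ^ 2 ∂γ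
        = σX ^ 2 := by
      have v2 : Var[fun z : ℝ × ℝ => z.2; γ] = σX ^ 2 := by
        have h := variance_id_gaussianReal (μ := μX) (v := (σX ^ 2).toNNReal)
        rw [← gauss_eq, ← h2, Real.coe_toNNReal _ (sq_nonneg σX),
          variance_id_map measurable_snd.aemeasurable] at h
        exact h
      rw [← v2, variance_eq_integral (by fun_prop), e0]
      congr 1; ext z; ring
    have e2 : ∫ z, (z.1 - γ[fun z : ℝ × ℝ => z.1]) ^ 2 ∂γ = Var[Y; μ] := by
      rw [← variance_id_map mY.aemeasurable, ← h1, variance_id_map measurable_fst.aemeasurable,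
        variance_eq_integral (by fun_prop)]
    have e3 : ∫ z, ((z.2 - z.1) - γ[fun z : ℝ × ℝ => z.2 - z.1]) ^ 2 ∂γ
        ≤ ∫ z, (z.2 - z.1) ^ 2 ∂γ := by
      rw [← variance_eq_integral (X := fun z : ℝ × ℝ => z.2 - z.1) (by fun_prop)]
      exact variance_le_expectation_sq (by fun_prop)
    rw [e1, e2, Real.sqrt_sq hσX.le] at hmk
    have := Real.sqrt_le_sqrt e3
    linarith
  -- conditional expectations
  have hm' : MeasurableSpace.comap U inferInstance ≤ (inferInstance : MeasurableSpace (ℝ × ℝ × ℝ)) :=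
    mU.comap_le
  set a := μ[X|MeasurableSpace.comap U inferInstance] with ha
  set b := μ[Y|MeasurableSpace.comap U inferInstance] with hb
  have la : MemLp a 2 μ := lX.condExp one_le_two
  have lb : MemLp b 2 μ := lY.condExp one_le_two
  have tX := total_var hm' μ X lX
  have tY := total_var hm' μ Y lY
  have bX : σX * expNeg R ≤ √(∫ w, (X w - a w) ^ 2 ∂μ) := by
    have hd : Measurable fun w => (X w, X w) := mX.prodMk mX
    have : IsProbabilityMeasure (μ.map fun w => (X w, X w)) :=
      Measure.isProbabilityMeasure_map hd.aemeasurable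
    have := core_condExp μ X U mX mU lX μX σX hσX (μ.map fun w => (X w, X w))
      (by rw [Measure.map_map measurable_snd hd]; exact hX)
      (by rw [Measure.map_map measurable_fst hd]; rfl)
      (by
        rw [memLp_map_measure_iff (by fun_prop) (by fun_prop)]
        refine (MemLp.zero (p := 2) (μ := μ) (ε := ℝ)).ae_eq (ae_of_all _ fun w => ?_)
        simp) R hI1
    rw [integral_map hd.aemeasurable (by fun_prop)] at this
    simpa using this
  have bY : σX * expNeg (R + Rc) - √P ≤ √(∫ w, (Y w - b w) ^ 2 ∂μ) := by
    rw [sub_le_iff_le_add']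
    refine le_of_forall_pos_le_add fun ε hε => ?_
    obtain ⟨γ, hγp, h1, h2, h3, h4⟩ := w2_coupling _ _ P (√P + ε) hP hW (by linarith)
    have := core_condExp μ Y U mY mU lY μX σX hσX γ h2 h1 h3 (R + Rc) hI2
    linarith
  have iX0 : 0 ≤ ∫ w, (X w - a w) ^ 2 ∂μ := integral_nonneg fun _ => sq_nonneg _
  have iY0 : 0 ≤ ∫ w, (Y w - b w) ^ 2 ∂μ := integral_nonneg fun _ => sq_nonneg _
  have bX2 : σX ^ 2 * expNeg (2 * R) ≤ ∫ w, (X w - a w) ^ 2 ∂μ := by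
    rw [expNeg_two_mul, ← mul_pow, ← Real.sq_sqrt iX0]
    have := expNeg_nonneg R
    gcongr
  set δ := max (σX * expNeg (R + Rc) - √P) 0 with hδ
  have bY2 : δ ^ 2 ≤ ∫ w, (Y w - b w) ^ 2 ∂μ := by
    rw [← Real.sq_sqrt iY0]
    have h0 : 0 ≤ δ := le_max_right _ _
    have h1 : δ ≤ √(∫ w, (Y w - b w) ^ 2 ∂μ) := max_le bY (Real.sqrt_nonneg _)
    gcongr
  -- covariance
  have hcov : cov[X, Y; μ] = cov[a, b; μ] := by
    rw [covariance_eq_sub lX lY, covariance_eq_sub la lb]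
    have e1 : μ[X * Y] = μ[a * b] := integral_mul_of_condIndep hm' μ mX mY lX lY hci
    have e2 : μ[a] = μ[X] := integral_condExp hm'
    have e3 : μ[b] = μ[Y] := integral_condExp hm'
    rw [e1, e2, e3]
  have hcs : cov[a, b; μ] ^ 2 ≤ Var[a; μ] * Var[b; μ] := by
    rw [variance_eq_integral la.aestronglyMeasurable.aemeasurable,
      variance_eq_integral lb.aestronglyMeasurable.aemeasurable]
    exact cs_int (la.sub (memLp_const _)) (lb.sub (memLp_const _))
  have hva := variance_nonneg a μ
  have hvb := variance_nonneg b μ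
  have hcov2 : cov[X, Y; μ] ≤ σX * √((1 - expNeg (2 * R)) * (s ^ 2 - δ ^ 2)) := by
    rw [hcov]
    refine (le_abs_self _).trans ((Real.abs_le_sqrt hcs).trans ?_)
    rw [show σX * √((1 - expNeg (2 * R)) * (s ^ 2 - δ ^ 2))
      = √(σX ^ 2 * ((1 - expNeg (2 * R)) * (s ^ 2 - δ ^ 2))) by
        rw [Real.sqrt_mul (sq_nonneg _), Real.sqrt_sq hσX.le], ← mul_assoc]
    apply Real.sqrt_le_sqrt
    apply mul_le_mul _ _ hvb
    · have := expNeg_le_one (2 * R)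
      have := sub_nonneg.2 this
      positivity
    · rw [vX] at tX; linarith
    · rw [hs2]; linarith
  -- distortion
  have lXY : MemLp (X - Y) 2 μ := lX.sub lY
  have hdist : distortion μ = ENNReal.ofReal (∫ w, (X w - Y w) ^ 2 ∂μ) := by
    exact (ofReal_integral_eq_lintegral_ofReal lXY.integrable_sq
      (ae_of_all _ fun _ => sq_nonneg _)).symm
  rw [hdist]
  apply ENNReal.ofReal_le_ofReal
  have hE : expNeg (R + Rc) ^ 2 ≤ expNeg (2 * R) := by
    rw [expNeg_two_mul]
    have := expNeg_nonneg (R + Rc)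
    have := expNeg_anti (x := R) (y := R + Rc) le_self_add
    gcongr
  apply final_analytic σX hσX _ _ P s _ (expNeg_nonneg _) (expNeg_le_one _) (expNeg_nonneg _) hE hs0
    hsl
  have hvd : Var[X - Y; μ] ≤ ∫ w, (X w - Y w) ^ 2 ∂μ :=
    variance_le_expectation_sq lXY.aestronglyMeasurable
  rw [variance_sub lX lY, vX] at hvd
  rw [← hδ]
  linarith

/-- Theorem 3 of Xie et al. (lower bound, squared Wasserstein-2 perception measure). -/
theorem stmt2 (μX σX : ℝ) (hσX : 0 < σX) (R Rc : ℝ≥0∞) (P : ℝ) (hP : 0 ≤ P) :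
    DRP (gauss μX σX) W2sq R Rc (ENNReal.ofReal P) ≥
      ENNReal.ofReal (sInf ((fun s => σX ^ 2 + s ^ 2 - 2 * σX *
          Real.sqrt ((1 - expNeg (2 * R)) *
            (s ^ 2 - max (σX * expNeg (R + Rc) - Real.sqrt P) 0 ^ 2)))
        '' Set.Icc (max (σX - Real.sqrt P) 0) σX)) := by
  unfold DRP
  exact le_iInf₂ fun μ hμ => bound_feasible μX σX hσX R Rc P hP μ hμ
end

section
/- Let p_X be the Gaussian distribution N(μ_X, σ_X²) with σ_X > 0, and let R, R_c ∈ [0,∞], P ∈ [0,∞). Then the distortion-rate-perception function with squared Wasserstein-2 perception measure satisfies the upper bound D(R,R_c,P|W₂²) ≤ σ_X² − σ_X² ξ(R,R_c)² + (max{σ_X − √P − σ_X ξ(R,R_c), 0})². -/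
open MeasureTheory ProbabilityTheory Real Set
open scoped ENNReal NNReal

/-- the standard Gaussian -/
noncomputable def stdG : Measure ℝ := gaussianReal 0 1

instance : IsProbabilityMeasure stdG := by unfold stdG; infer_instance

/-- square as a nonnegative real -/
noncomputable def sqN (c : ℝ) : ℝ≥0 := Real.toNNReal (c ^ 2)

@[simp] lemma coe_sqN (c : ℝ) : ((sqN c : ℝ≥0) : ℝ) = c ^ 2 :=
  Real.coe_toNNReal _ (sq_nonneg c)

lemma gauss_eq_s3 (a s : ℝ) : gauss a s = gaussianReal a (sqN s) := by
  unfold gauss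
  congr 1
  apply NNReal.coe_injective
  rw [coe_sqN]
  rfl

lemma map_add_conv (μ₁ μ₂ : Measure ℝ) [IsProbabilityMeasure μ₁] [IsProbabilityMeasure μ₂]
    {α β : Type*} [MeasurableSpace α] [MeasurableSpace β] (m₁ : Measure α) (m₂ : Measure β)
    [IsProbabilityMeasure m₁] [IsProbabilityMeasure m₂] (f : α → ℝ) (g : β → ℝ)
    (hf : Measurable f) (hg : Measurable g) (h1 : m₁.map f = μ₁) (h2 : m₂.map g = μ₂) :
    (m₁.prod m₂).map (fun p => f p.1 + g p.2) = μ₁.conv μ₂ := by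
  subst h1 h2
  unfold Measure.conv
  rw [Measure.map_prod_map _ _ hf hg, Measure.map_map (by fun_prop) (by fun_prop)]
  rfl

lemma lin1 (a c : ℝ) : stdG.map (fun z => a + c * z) = gaussianReal a (sqN c) := by
  have : (fun z => a + c * z) = (fun x : ℝ => a + x) ∘ (fun z : ℝ => c * z) := rfl
  rw [this, ← Measure.map_map (by fun_prop) (by fun_prop), stdG, gaussianReal_map_const_mul,
    gaussianReal_map_const_add]
  congr 1
  · simp
  · apply NNReal.coe_injective; simp

lemma lin2 (a b c : ℝ) (v : ℝ≥0) (hv : (v : ℝ) = b ^ 2 + c ^ 2) :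
    (stdG.prod stdG).map (fun p => a + b * p.1 + c * p.2) = gaussianReal a v := by
  rw [map_add_conv (gaussianReal a (sqN b)) (gaussianReal 0 (sqN c)) stdG stdG
    (fun u => a + b * u) (fun z => c * z) (by fun_prop) (by fun_prop) (lin1 a b)
    (by simpa using lin1 0 c), gaussianReal_conv_gaussianReal]
  congr 1
  · simp
  · apply NNReal.coe_injective; simp [hv]

lemma lin3 (b c d : ℝ) (v : ℝ≥0) (hv : (v : ℝ) = b ^ 2 + c ^ 2 + d ^ 2) :
    (stdG.prod (stdG.prod stdG)).map (fun p => b * p.1 + (c * p.2.1 + d * p.2.2))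
      = gaussianReal 0 v := by
  rw [map_add_conv (gaussianReal 0 (sqN b))
    (gaussianReal 0 (sqN c + sqN d)) stdG (stdG.prod stdG)
    (fun u => b * u) (fun z => c * z.1 + d * z.2) (by fun_prop) (by fun_prop)
    (by simpa using lin1 0 b)
    (by simpa using lin2 0 c d (sqN c + sqN d) (by simp)), gaussianReal_conv_gaussianReal]
  congr 1
  · simp
  · apply NNReal.coe_injective; simp [hv, add_assoc]

lemma gauss_sq_integrable (a : ℝ) (v : ℝ≥0) :
    Integrable (fun x => (x - a) ^ 2) (gaussianReal a v) := by
  have h := (memLp_id_gaussianReal' (μ := a) (v := v) 2 (by simp))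
  exact (h.sub (memLp_const a)).integrable_sq

lemma gauss_sq (a : ℝ) (v : ℝ≥0) : ∫ x, (x - a) ^ 2 ∂(gaussianReal a v) = v := by
  have h := variance_fun_id_gaussianReal (μ := a) (v := v)
  rw [variance_eq_integral (by fun_prop)] at h
  simpa [integral_id_gaussianReal] using h

lemma gauss_lint_sq (v : ℝ≥0) : ∫⁻ x, ENNReal.ofReal (x ^ 2) ∂(gaussianReal 0 v) = v := by
  have h1 := gauss_sq_integrable 0 v
  have h2 := gauss_sq 0 v
  simp only [sub_zero] at h1 h2
  rw [← ofReal_integral_eq_lintegral_ofReal h1 (Filter.Eventually.of_forall fun x => sq_nonneg x),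
    h2, ENNReal.ofReal_coe_nnreal]

lemma KLD_eq {α : Type*} [MeasurableSpace α] (q p : Measure α) [IsProbabilityMeasure p]
    (L : α → ℝ) (hL : Measurable L)
    (hq : q = p.withDensity (fun x => ENNReal.ofReal (Real.exp (L x)))) (hi : Integrable L q) :
    KLD q p = ENNReal.ofReal (∫ x, L x ∂q) := by
  have hac : q ≪ p := by rw [hq]; exact withDensity_absolutelyContinuous _ _
  have h1 : q.rnDeriv p =ᵐ[p] (fun x => ENNReal.ofReal (Real.exp (L x))) := by
    rw [hq]; exact Measure.rnDeriv_withDensity p (by fun_prop)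
  have h2 : (fun x => Real.log (q.rnDeriv p x).toReal) =ᵐ[q] L := by
    filter_upwards [hac.ae_le h1] with x hx
    rw [hx, ENNReal.toReal_ofReal (Real.exp_pos _).le, Real.log_exp]
  unfold KLD
  rw [if_pos ⟨hac, hi.congr h2.symm⟩, integral_congr_ae h2]

/-- joint law of `(a + bU + cZ, U)` -/
noncomputable def QQ (a b c : ℝ) : Measure (ℝ × ℝ) :=
  (stdG.prod stdG).map (fun p => (a + b * p.1 + c * p.2, p.1))

/-- log density -/
noncomputable def LL (a b c s : ℝ) (p : ℝ × ℝ) : ℝ :=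
  Real.log (s / c) - (p.1 - (a + b * p.2)) ^ 2 / (2 * c ^ 2) + (p.1 - a) ^ 2 / (2 * s ^ 2)

lemma pdf_ratio (a b c s : ℝ) (hc : 0 < c) (hs : 0 < s) (x u : ℝ) :
    gaussianPDF (a + b * u) (sqN c) x =
      gaussianPDF a (sqN s) x * ENNReal.ofReal (Real.exp (LL a b c s (x, u))) := by
  unfold gaussianPDF
  rw [← ENNReal.ofReal_mul (gaussianPDFReal_nonneg _ _ _)]
  congr 1
  unfold gaussianPDFReal LL
  have hsc : 0 < s / c := by positivity
  have e1 : √(2 * π * (c ^ 2)) = √(2 * π) * c := by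
    rw [Real.sqrt_mul (by positivity), Real.sqrt_sq hc.le]
  have e2 : √(2 * π * (s ^ 2)) = √(2 * π) * s := by
    rw [Real.sqrt_mul (by positivity), Real.sqrt_sq hs.le]
  simp only [coe_sqN]
  rw [e1, e2, Real.exp_add, Real.exp_sub, Real.exp_log hsc, neg_div, neg_div, Real.exp_neg,
    Real.exp_neg]
  field_simp

lemma QQ_density (a b c s : ℝ) (hc : 0 < c) (hs : 0 < s) :
    QQ a b c = ((gaussianReal a (sqN s)).prod stdG).withDensity
      (fun x => ENNReal.ofReal (Real.exp (LL a b c s x))) := by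
  have hLm : Measurable (LL a b c s) := by unfold LL; fun_prop
  have hc' : sqN c ≠ 0 := by
    intro h; have := congrArg NNReal.toReal h; simp at this; exact hc.ne' this
  have hs' : sqN s ≠ 0 := by
    intro h; have := congrArg NNReal.toReal h; simp at this; exact hs.ne' this
  refine Measure.ext_of_lintegral _ fun f hf => ?_
  rw [lintegral_withDensity_eq_lintegral_mul _ (by fun_prop) hf, QQ,
    lintegral_map hf (by fun_prop), lintegral_prod _ (by fun_prop),
    lintegral_prod_symm _ (by fun_prop)]
  refine lintegral_congr fun u => ?_
  have h := lin1 (a + b * u) c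
  have h3 : ∫⁻ z, f (a + b * u + c * z, u) ∂stdG =
      ∫⁻ x, f (x, u) ∂(gaussianReal (a + b * u) (sqN c)) := by
    rw [← h, lintegral_map (by fun_prop) (by fun_prop)]
  simp only
  rw [h3, gaussianReal_of_var_ne_zero _ hc', gaussianReal_of_var_ne_zero _ hs',
    lintegral_withDensity_eq_lintegral_mul _ (by fun_prop) (by fun_prop),
    lintegral_withDensity_eq_lintegral_mul _ (by fun_prop) (by fun_prop)]
  refine lintegral_congr fun x => ?_
  simp only [Pi.mul_apply]
  rw [pdf_ratio a b c s hc hs, mul_assoc]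

lemma QQ_snd (a b c : ℝ) : (QQ a b c).map Prod.snd = stdG := by
  rw [QQ, Measure.map_map (by fun_prop) (by fun_prop)]
  change (stdG.prod stdG).map Prod.fst = _
  simp

lemma QQ_fst (a b c : ℝ) (v : ℝ≥0) (hv : (v : ℝ) = b ^ 2 + c ^ 2) :
    (QQ a b c).map Prod.fst = gaussianReal a v := by
  rw [QQ, Measure.map_map (by fun_prop) (by fun_prop)]
  exact lin2 a b c v hv

lemma QQ_L (a b c s : ℝ) (hc : 0 < c) (hs : 0 < s) (h : s ^ 2 = b ^ 2 + c ^ 2) :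
    Integrable (LL a b c s) (QQ a b c) ∧ ∫ x, LL a b c s x ∂(QQ a b c) = Real.log (s / c) := by
  have hLm : Measurable (LL a b c s) := by unfold LL; fun_prop
  have hm : Measurable (fun p : ℝ × ℝ => (a + b * p.1 + c * p.2, p.1)) := by fun_prop
  rw [QQ, integrable_map_measure hLm.aestronglyMeasurable hm.aemeasurable,
    integral_map hm.aemeasurable hLm.aestronglyMeasurable]
  have l1 := lin2 a b c (sqN s) (by rw [coe_sqN, h])
  have l2 := lin2 0 0 1 1 (by simp)
  have hm1 : Measurable (fun p : ℝ × ℝ => a + b * p.1 + c * p.2) := by fun_prop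
  have hm2 : Measurable (fun p : ℝ × ℝ => 0 + 0 * p.1 + 1 * p.2) := by fun_prop
  have hq (t : ℝ) : Measurable (fun x : ℝ => (x - t) ^ 2) := by fun_prop
  have i1 := gauss_sq_integrable a (sqN s)
  have i2 := gauss_sq_integrable 0 1
  have j1 := gauss_sq a (sqN s)
  have j2 := gauss_sq 0 1
  rw [← l1, integrable_map_measure (hq a).aestronglyMeasurable hm1.aemeasurable] at i1
  rw [← l1, integral_map hm1.aemeasurable (hq a).aestronglyMeasurable] at j1
  rw [← l2, integrable_map_measure (hq 0).aestronglyMeasurable hm2.aemeasurable] at i2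
  rw [← l2, integral_map hm2.aemeasurable (hq 0).aestronglyMeasurable] at j2
  have e : (fun p : ℝ × ℝ => LL a b c s (a + b * p.1 + c * p.2, p.1)) =
      fun p => (Real.log (s / c) - (0 + 0 * p.1 + 1 * p.2 - 0) ^ 2 / 2)
        + (a + b * p.1 + c * p.2 - a) ^ 2 / (2 * s ^ 2) := by
    funext p
    unfold LL
    field_simp
    ring
  have k2 : Integrable (fun p : ℝ × ℝ => (0 + 0 * p.1 + 1 * p.2 - 0) ^ 2 / 2) (stdG.prod stdG) :=
    i2.div_const 2
  have k1 : Integrable (fun p : ℝ × ℝ => (a + b * p.1 + c * p.2 - a) ^ 2 / (2 * s ^ 2))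
      (stdG.prod stdG) := i1.div_const (2 * s ^ 2)
  have k0 : Integrable (fun _ : ℝ × ℝ => Real.log (s / c)) (stdG.prod stdG) := integrable_const _
  constructor
  · change Integrable (fun p : ℝ × ℝ => LL a b c s (a + b * p.1 + c * p.2, p.1)) _
    rw [e]
    exact (k0.sub k2).add k1
  · rw [e, integral_add (by exact k0.sub k2) k1, integral_sub k0 k2, integral_div, integral_div, j1, j2]
    simp
    field_simp
    ring

lemma mutInfo_QQ {Ω : Type*} [MeasurableSpace Ω] (μ : Measure Ω) (f g : Ω → ℝ)
    (hf : Measurable f) (hg : Measurable g) (a s ρ : ℝ) (hs : 0 ≤ s)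
    (r : ℝ≥0∞) (hρ : 1 - ρ ^ 2 = expNeg (2 * r))
    (h : μ.map (fun ω => (f ω, g ω)) = QQ a (s * ρ) (s * √(1 - ρ ^ 2))) :
    mutInfo μ f g ≤ r := by
  by_cases hr : r = ⊤
  · simp [hr]
  have hr2 : 2 * r ≠ ⊤ := ENNReal.mul_ne_top (by simp) hr
  have he : 1 - ρ ^ 2 = Real.exp (-(2 * r.toReal)) := by
    rw [hρ, expNeg, if_neg hr2]; simp
  have hsq : √(1 - ρ ^ 2) = Real.exp (-r.toReal) := by
    rw [he, show -(2 * r.toReal) = -r.toReal + -r.toReal by ring, Real.exp_add,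
      Real.sqrt_mul_self (Real.exp_pos _).le]
  have hv : s ^ 2 = (s * ρ) ^ 2 + (s * √(1 - ρ ^ 2)) ^ 2 := by
    rw [mul_pow, mul_pow, Real.sq_sqrt (by rw [he]; positivity)]; ring
  have mg : μ.map g = stdG := by
    rw [← QQ_snd a (s * ρ) (s * √(1 - ρ ^ 2)), ← h, Measure.map_map (by fun_prop) (by fun_prop)]
    rfl
  have mf : μ.map f = gaussianReal a (sqN s) := by
    rw [← QQ_fst a (s * ρ) (s * √(1 - ρ ^ 2)) (sqN s) (by rw [coe_sqN, hv]), ← h,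
      Measure.map_map (by fun_prop) (by fun_prop)]
    rfl
  unfold mutInfo
  rw [h, mf, mg]
  rcases hs.eq_or_lt with rfl | hs
  · have e : QQ a (0 * ρ) (0 * √(1 - ρ ^ 2)) =
        (gaussianReal a (sqN 0)).prod stdG := by
      have : sqN 0 = 0 := by apply NNReal.coe_injective; simp
      rw [this, gaussianReal_zero_var, Measure.dirac_prod, QQ]
      have : (fun p : ℝ × ℝ => (a + 0 * ρ * p.1 + 0 * √(1 - ρ ^ 2) * p.2, p.1))
        = (Prod.mk a) ∘ Prod.fst := by funext p; simp
      rw [this, ← Measure.map_map (by fun_prop) (by fun_prop)]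
      simp
    rw [e, KLD_eq _ _ (fun _ => 0) (by fun_prop) (by simp) (by simp)]
    simp
  · have hc : 0 < s * √(1 - ρ ^ 2) := by rw [hsq]; positivity
    obtain ⟨h1, h2⟩ := QQ_L a _ _ s hc hs hv
    rw [KLD_eq _ _ _ (by unfold LL; fun_prop) (QQ_density a _ _ s hc hs) h1, h2, hsq]
    rw [show s / (s * Real.exp (-r.toReal)) = Real.exp r.toReal by
      rw [Real.exp_neg]; field_simp, Real.log_exp, ENNReal.ofReal_toReal hr]

lemma expNeg_bounds (x : ℝ≥0∞) : 0 ≤ expNeg x ∧ expNeg x ≤ 1 := by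
  unfold expNeg
  split_ifs
  · simp
  · exact ⟨(Real.exp_pos _).le, Real.exp_le_one_iff.2 (by simp)⟩

/-- the conditional law of `a + bU + cZ` given `U` -/
noncomputable def KK (a b c : ℝ) : Kernel ℝ ℝ :=
  (Kernel.id ×ₖ Kernel.const ℝ stdG).map (fun p : ℝ × ℝ => a + b * p.1 + c * p.2)

instance (a b c : ℝ) : IsMarkovKernel (KK a b c) := by
  unfold KK
  exact Kernel.IsMarkovKernel.map _ (by fun_prop)

lemma KK_lint (a b c u : ℝ) (f : ℝ → ℝ≥0∞) (hf : Measurable f) :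
    ∫⁻ x, f x ∂(KK a b c u) = ∫⁻ z, f (a + b * u + c * z) ∂stdG := by
  unfold KK
  rw [Kernel.map_apply _ (by fun_prop), lintegral_map hf (by fun_prop), Kernel.prod_apply,
    lintegral_prod _ (by fun_prop), Kernel.id_apply, lintegral_dirac' _ (by fun_prop)]
  simp

/-- the linear map defining the test channel -/
noncomputable def TT (a b₁ c₁ b₂ c₂ : ℝ) (w : ℝ × ℝ × ℝ) : ℝ × ℝ × ℝ :=
  (a + b₁ * w.1 + c₁ * w.2.1, w.1, a + b₂ * w.1 + c₂ * w.2.2)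

lemma TT_meas (a b₁ c₁ b₂ c₂ : ℝ) : Measurable (TT a b₁ c₁ b₂ c₂) := by unfold TT; fun_prop

/-- the joint law of the test channel -/
noncomputable def MM (a b₁ c₁ b₂ c₂ : ℝ) : Measure (ℝ × ℝ × ℝ) :=
  (stdG.prod (stdG.prod stdG)).map (TT a b₁ c₁ b₂ c₂)

instance (a b₁ c₁ b₂ c₂ : ℝ) : IsProbabilityMeasure (MM a b₁ c₁ b₂ c₂) :=
  Measure.isProbabilityMeasure_map (TT_meas _ _ _ _ _).aemeasurable

lemma MM_XU (a b₁ c₁ b₂ c₂ : ℝ) :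
    (MM a b₁ c₁ b₂ c₂).map (fun w => (w.1, w.2.1)) = QQ a b₁ c₁ := by
  refine Measure.ext_of_lintegral _ fun f hf => ?_
  rw [MM, QQ, lintegral_map hf (by fun_prop), lintegral_map (by fun_prop) (TT_meas _ _ _ _ _),
    lintegral_map hf (by fun_prop)]
  unfold TT
  rw [lintegral_prod _ (by fun_prop), lintegral_prod _ (by fun_prop)]
  refine lintegral_congr fun u => ?_
  rw [lintegral_prod _ (by fun_prop)]
  simp

lemma MM_YU (a b₁ c₁ b₂ c₂ : ℝ) :
    (MM a b₁ c₁ b₂ c₂).map (fun w => (w.2.2, w.2.1)) = QQ a b₂ c₂ := by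
  refine Measure.ext_of_lintegral _ fun f hf => ?_
  rw [MM, QQ, lintegral_map hf (by fun_prop), lintegral_map (by fun_prop) (TT_meas _ _ _ _ _),
    lintegral_map hf (by fun_prop)]
  unfold TT
  rw [lintegral_prod _ (by fun_prop), lintegral_prod _ (by fun_prop)]
  refine lintegral_congr fun u => ?_
  rw [lintegral_prod _ (by fun_prop)]
  simp

lemma MM_X (a b₁ c₁ b₂ c₂ : ℝ) (v : ℝ≥0) (hv : (v : ℝ) = b₁ ^ 2 + c₁ ^ 2) :
    (MM a b₁ c₁ b₂ c₂).map (fun w => w.1) = gaussianReal a v := by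
  rw [← QQ_fst a b₁ c₁ v hv, ← MM_XU a b₁ c₁ b₂ c₂, Measure.map_map (by fun_prop) (by fun_prop)]
  rfl

lemma MM_Y (a b₁ c₁ b₂ c₂ : ℝ) (v : ℝ≥0) (hv : (v : ℝ) = b₂ ^ 2 + c₂ ^ 2) :
    (MM a b₁ c₁ b₂ c₂).map (fun w => w.2.2) = gaussianReal a v := by
  rw [← QQ_fst a b₂ c₂ v hv, ← MM_YU a b₁ c₁ b₂ c₂, Measure.map_map (by fun_prop) (by fun_prop)]
  rfl

lemma MM_cond (a b₁ c₁ b₂ c₂ : ℝ) :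
    CondIndepFun (MeasurableSpace.comap (fun w : ℝ × ℝ × ℝ => w.2.1) inferInstance)
      ((measurable_fst.comp measurable_snd).comap_le)
      (fun w : ℝ × ℝ × ℝ => w.1) (fun w : ℝ × ℝ × ℝ => w.2.2) (MM a b₁ c₁ b₂ c₂) := by
  have hT := TT_meas a b₁ c₁ b₂ c₂
  refine (condIndepFun_iff_condDistrib_prod_ae_eq_prodMkRight (μ := MM a b₁ c₁ b₂ c₂)
    (f := fun w : ℝ × ℝ × ℝ => w.2.2) (g := fun w : ℝ × ℝ × ℝ => w.1)
    (k := fun w : ℝ × ℝ × ℝ => w.2.1) (by fun_prop) (by fun_prop) (by fun_prop)).2 ?_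
  have h1 : condDistrib (fun w : ℝ × ℝ × ℝ => w.2.2) (fun w : ℝ × ℝ × ℝ => (w.2.1, w.1))
      (MM a b₁ c₁ b₂ c₂) =ᵐ[(MM a b₁ c₁ b₂ c₂).map (fun w => (w.2.1, w.1))]
      (KK a b₂ c₂).prodMkRight ℝ := by
    refine condDistrib_ae_eq_of_measure_eq_compProd _ (by fun_prop) ?_
    refine Measure.ext_of_lintegral _ fun f hf => ?_
    rw [Measure.lintegral_compProd hf, lintegral_map hf (by fun_prop),
      lintegral_map (hf.lintegral_kernel_prod_right') (by fun_prop), MM,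
      lintegral_map (by fun_prop) hT, lintegral_map ?_ hT]
    · have : ∀ w : ℝ × ℝ × ℝ, ∫⁻ x, f (((TT a b₁ c₁ b₂ c₂ w).2.1, (TT a b₁ c₁ b₂ c₂ w).1), x)
          ∂((KK a b₂ c₂).prodMkRight ℝ ((TT a b₁ c₁ b₂ c₂ w).2.1, (TT a b₁ c₁ b₂ c₂ w).1)) =
          ∫⁻ z, f ((w.1, a + b₁ * w.1 + c₁ * w.2.1), a + b₂ * w.1 + c₂ * z) ∂stdG := by
        intro w
        rw [Kernel.prodMkRight_apply, KK_lint _ _ _ _ _ (by fun_prop)]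
        rfl
      simp only [this]
      unfold TT
      rw [lintegral_prod _ (by fun_prop), lintegral_prod _ ?_]
      · refine lintegral_congr fun u => ?_
        rw [lintegral_prod _ (by fun_prop), lintegral_prod _ ?_]
        · simp
        · refine Measurable.aemeasurable ?_
          exact Measurable.lintegral_prod_right'
            (f := fun q : (ℝ × ℝ) × ℝ => f ((u, a + b₁ * u + c₁ * q.1.1), a + b₂ * u + c₂ * q.2))
            (by fun_prop)
      · refine Measurable.aemeasurable ?_
        exact Measurable.lintegral_prod_right'
          (f := fun q : (ℝ × ℝ × ℝ) × ℝ => f ((q.1.1, a + b₁ * q.1.1 + c₁ * q.1.2.1),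
            a + b₂ * q.1.1 + c₂ * q.2)) (by fun_prop)
    · have hq : Measurable (fun q : ℝ × ℝ × ℝ => (q.2.1, q.1)) := by fun_prop
      exact (hf.lintegral_kernel_prod_right' (κ := (KK a b₂ c₂).prodMkRight ℝ)).comp hq
  have h2 : condDistrib (fun w : ℝ × ℝ × ℝ => w.2.2) (fun w : ℝ × ℝ × ℝ => w.2.1)
      (MM a b₁ c₁ b₂ c₂) =ᵐ[(MM a b₁ c₁ b₂ c₂).map (fun w => w.2.1)] KK a b₂ c₂ := by
    refine condDistrib_ae_eq_of_measure_eq_compProd _ (by fun_prop) ?_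
    have e1 : (MM a b₁ c₁ b₂ c₂).map (fun w => w.2.1) = stdG := by
      rw [← QQ_snd a b₂ c₂, ← MM_YU a b₁ c₁ b₂ c₂, Measure.map_map (by fun_prop) (by fun_prop)]
      rfl
    have e2 : (MM a b₁ c₁ b₂ c₂).map (fun w => (w.2.1, w.2.2)) = (QQ a b₂ c₂).map Prod.swap := by
      rw [← MM_YU a b₁ c₁ b₂ c₂, Measure.map_map (by fun_prop) (by fun_prop)]
      rfl
    rw [e1, e2, QQ, Measure.map_map (by fun_prop) (by fun_prop)]
    refine Measure.ext_of_lintegral _ fun f hf => ?_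
    rw [Measure.lintegral_compProd hf, lintegral_map hf (by fun_prop),
      lintegral_prod _ (by fun_prop)]
    refine lintegral_congr fun u => ?_
    rw [KK_lint _ _ _ _ _ (by fun_prop)]
    rfl
  have h3 : (MM a b₁ c₁ b₂ c₂).map (fun w => w.2.1) =
      ((MM a b₁ c₁ b₂ c₂).map (fun w => (w.2.1, w.1))).map Prod.fst := by
    rw [Measure.map_map (by fun_prop) (by fun_prop)]; rfl
  rw [h3] at h2
  have h4 := ae_of_ae_map (by fun_prop) h2
  filter_upwards [h1, h4] with x hx1 hx2
  rw [hx1, Kernel.prodMkRight_apply, Kernel.prodMkRight_apply, hx2]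

lemma W2_le (a s t : ℝ) :
    W2sq (gaussianReal a (sqN s)) (gaussianReal a (sqN t)) ≤ ENNReal.ofReal ((s - t) ^ 2) := by
  unfold W2sq
  have hm : Measurable (fun z : ℝ => (a + s * z, a + t * z)) := by fun_prop
  refine (iInf_le _ (stdG.map (fun z => (a + s * z, a + t * z)))).trans ?_
  refine (iInf_le _ (Measure.isProbabilityMeasure_map hm.aemeasurable)).trans ?_
  refine (iInf_le _ ?_).trans ((iInf_le _ ?_).trans ?_)
  · rw [Measure.map_map (by fun_prop) hm]; exact lin1 a s
  · rw [Measure.map_map (by fun_prop) hm]; exact lin1 a t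
  · rw [lintegral_map (by fun_prop) hm]
    have : ∀ z : ℝ, ENNReal.ofReal ((a + s * z - (a + t * z)) ^ 2) =
        ENNReal.ofReal ((s - t) ^ 2) * ENNReal.ofReal (z ^ 2) := by
      intro z
      rw [← ENNReal.ofReal_mul (sq_nonneg _)]
      congr 1; ring
    simp only [this]
    rw [lintegral_const_mul _ (by fun_prop), stdG, gauss_lint_sq]
    simp

lemma MM_dist (a b₁ c₁ b₂ c₂ : ℝ) :
    distortion (MM a b₁ c₁ b₂ c₂) = ENNReal.ofReal ((b₁ - b₂) ^ 2 + c₁ ^ 2 + c₂ ^ 2) := by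
  unfold distortion
  rw [MM, lintegral_map (by fun_prop) (TT_meas _ _ _ _ _)]
  have h := lin3 (b₁ - b₂) c₁ (-c₂) (Real.toNNReal ((b₁ - b₂) ^ 2 + c₁ ^ 2 + c₂ ^ 2))
    (by rw [Real.coe_toNNReal _ (by positivity)]; ring)
  have h2 := gauss_lint_sq (Real.toNNReal ((b₁ - b₂) ^ 2 + c₁ ^ 2 + c₂ ^ 2))
  rw [← h, lintegral_map (by fun_prop) (by fun_prop)] at h2
  rw [ENNReal.ofReal, ← h2]
  refine lintegral_congr fun w => ?_
  unfold TT
  congr 1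
  ring

/-- Theorem 3 of Xie et al. (upper bound, squared Wasserstein-2 perception measure). -/
theorem stmt3 (μX σX : ℝ) (hσX : 0 < σX) (R Rc : ℝ≥0∞) (P : ℝ) (hP : 0 ≤ P) :
    DRP (gauss μX σX) W2sq R Rc (ENNReal.ofReal P) ≤
      ENNReal.ofReal (σX ^ 2 - σX ^ 2 * xiRRc R Rc ^ 2 +
        max (σX - Real.sqrt P - σX * xiRRc R Rc) 0 ^ 2) := by
  obtain ⟨A0, A1⟩ := expNeg_bounds (2 * R)
  obtain ⟨B0, B1⟩ := expNeg_bounds (2 * (R + Rc))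
  set ρ := √(1 - expNeg (2 * R)) with hρ
  set τ := √(1 - expNeg (2 * (R + Rc))) with hτ
  have hρ2 : ρ ^ 2 = 1 - expNeg (2 * R) := Real.sq_sqrt (by linarith)
  have hτ2 : τ ^ 2 = 1 - expNeg (2 * (R + Rc)) := Real.sq_sqrt (by linarith)
  have hξ : xiRRc R Rc = ρ * τ := by
    unfold xiRRc; rw [Real.sqrt_mul (by linarith)]
  rw [hξ]
  have hρ0 : 0 ≤ ρ := Real.sqrt_nonneg _
  have hτ0 : 0 ≤ τ := Real.sqrt_nonneg _
  have hρ1 : ρ ≤ 1 := by nlinarith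
  have hτ1 : τ ≤ 1 := by nlinarith
  have hξ1 : ρ * τ ≤ 1 := mul_le_one₀ hρ1 hτ0 hτ1
  have hξ0 : 0 ≤ ρ * τ := mul_nonneg hρ0 hτ0
  set s := max (σX - √P) (σX * (ρ * τ)) with hs
  have hs0 : 0 ≤ s := le_max_of_le_right (by positivity)
  have hsP : σX - s ≤ √P := by have := le_max_left (σX - √P) (σX * (ρ * τ)); linarith
  have hsX : s ≤ σX := max_le (by have := Real.sqrt_nonneg P; linarith) (by nlinarith)
  have q1 : √(1 - ρ ^ 2) ^ 2 = 1 - ρ ^ 2 := Real.sq_sqrt (by nlinarith)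
  have q2 : √(1 - τ ^ 2) ^ 2 = 1 - τ ^ 2 := Real.sq_sqrt (by nlinarith)
  have hmax : max (σX - √P - σX * (ρ * τ)) 0 = s - σX * (ρ * τ) := by
    rw [hs, ← max_sub_sub_right, sub_self]
  have v1 : ((sqN σX : ℝ≥0) : ℝ) = (σX * ρ) ^ 2 + (σX * √(1 - ρ ^ 2)) ^ 2 := by
    rw [coe_sqN, mul_pow, mul_pow, q1]; ring
  have v2 : ((sqN s : ℝ≥0) : ℝ) = (s * τ) ^ 2 + (s * √(1 - τ ^ 2)) ^ 2 := by
    rw [coe_sqN, mul_pow, mul_pow, q2]; ring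
  unfold DRP
  refine (iInf_le _ (MM μX (σX * ρ) (σX * √(1 - ρ ^ 2)) (s * τ) (s * √(1 - τ ^ 2)))).trans ?_
  refine (iInf_le _ ?_).trans ?_
  · refine ⟨inferInstance, ?_, MM_cond _ _ _ _ _, ?_, ?_, ?_⟩
    · rw [gauss_eq_s3]; exact MM_X _ _ _ _ _ _ v1
    · exact mutInfo_QQ _ _ _ (by fun_prop) (by fun_prop) μX σX ρ hσX.le R (by linarith)
        (MM_XU _ _ _ _ _)
    · exact mutInfo_QQ _ _ _ (by fun_prop) (by fun_prop) μX s τ hs0 (R + Rc) (by linarith)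
        (MM_YU _ _ _ _ _)
    · rw [gauss_eq_s3, MM_Y _ _ _ _ _ _ v2]
      refine (W2_le _ _ _).trans (ENNReal.ofReal_le_ofReal ?_)
      rw [← Real.sq_sqrt hP]
      exact pow_le_pow_left₀ (by linarith) hsP 2
  · rw [MM_dist, hmax]
    apply le_of_eq
    congr 1
    rw [mul_pow, mul_pow, q1, q2]
    ring
end

section
/- Refined Talagrand transportation inequality: let p_X be the Gaussian distribution N(μ_X, σ_X²) with σ_X > 0, and let p_X̂ be a probability measure on ℝ with finite second moment whose mean equals μ_X and whose standard deviation σ_X̂ satisfies σ_X̂ ≤ σ_X. Then W₂²(p_X, p_X̂) ≤ 2 σ_X² (1 − e^{−φ_KL(p_X̂‖p_X)}). -/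
open MeasureTheory ProbabilityTheory Real Set
open scoped ENNReal NNReal

open Filter Topology in
lemma aux_cdf_continuous (q : Measure ℝ) [IsProbabilityMeasure q] (h : ∀ x, q {x} = 0) :
    Continuous (cdf q) := by
  rw [continuous_iff_continuousAt]
  intro a
  have h1 : (cdf q).measure {a} = 0 := by rw [measure_cdf]; exact h a
  rw [StieltjesFunction.measure_singleton, ENNReal.ofReal_eq_zero] at h1
  have h2 : Function.leftLim (cdf q) a ≤ cdf q a := (monotone_cdf q).leftLim_le le_rfl
  rw [(monotone_cdf q).continuousAt_iff_leftLim_eq_rightLim, StieltjesFunction.rightLim_eq]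
  linarith

open Filter Topology in
lemma aux_cdf_exists (q : Measure ℝ) [IsProbabilityMeasure q] (h : ∀ x, q {x} = 0)
    {u : ℝ} (h0 : 0 < u) (h1 : u < 1) : ∃ t, cdf q t = u ∧ ∀ y, cdf q y = u → y ≤ t := by
  have hc := aux_cdf_continuous q h
  obtain ⟨a, ha⟩ := ((tendsto_cdf_atBot q).eventually (gt_mem_nhds h0)).exists
  obtain ⟨b, hb⟩ := ((tendsto_cdf_atTop q).eventually (lt_mem_nhds h1)).exists
  have hne : (cdf q ⁻¹' {u}).Nonempty := by
    obtain ⟨c, hc⟩ := mem_range_of_exists_le_of_exists_ge hc ⟨a, ha.le⟩ ⟨b, hb.le⟩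
    exact ⟨c, hc⟩
  have hsub : cdf q ⁻¹' {u} ⊆ Icc a b := by
    intro y hy
    have hy : cdf q y = u := hy
    constructor
    · by_contra! hlt
      have := monotone_cdf q hlt.le
      linarith
    · by_contra! hlt
      have := monotone_cdf q hlt.le
      linarith
  have hcomp : IsCompact (cdf q ⁻¹' {u}) :=
    isCompact_Icc.of_isClosed_subset (isClosed_singleton.preimage hc) hsub
  obtain ⟨t, ht, ht2⟩ := hcomp.exists_isGreatest hne
  exact ⟨t, ht, fun y hy => ht2 hy⟩

lemma aux_cdf_le (q : Measure ℝ) [IsProbabilityMeasure q] (h : ∀ x, q {x} = 0)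
    {u : ℝ} (h0 : 0 < u) (h1 : u < 1) : q {y | cdf q y ≤ u} = ENNReal.ofReal u := by
  obtain ⟨t, ht, ht2⟩ := aux_cdf_exists q h h0 h1
  have : {y | cdf q y ≤ u} = Iic t := by
    ext y
    simp only [mem_ofPred_eq, mem_Iic]
    constructor
    · intro hy
      by_contra! hlt
      have h3 := monotone_cdf q hlt.le
      have := ht2 y (by linarith)
      linarith
    · intro hy
      have := monotone_cdf q hy
      linarith
  rw [this, ← ofReal_cdf, ht]

open Filter Topology in
lemma aux_cdf_mem (q : Measure ℝ) [IsProbabilityMeasure q] (h : ∀ x, q {x} = 0) :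
    ∀ᵐ y ∂q, 0 < cdf q y ∧ cdf q y < 1 := by
  have hc := aux_cdf_continuous q h
  have A : ∀ᵐ y ∂q, 0 < cdf q y := by
    rw [ae_iff]
    have hle : ∀ n : ℕ, q {y | ¬ 0 < cdf q y} ≤ ENNReal.ofReal (1 / ((n : ℝ) + 2)) := by
      intro n
      have hp : (0 : ℝ) < 1 / ((n : ℝ) + 2) := by positivity
      rw [← aux_cdf_le q h hp (by rw [div_lt_one (by positivity)]; linarith [n.cast_nonneg (α := ℝ)])]
      apply measure_mono
      intro y hy
      simp only [mem_ofPred_eq] at hy ⊢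
      linarith
    have ht : Tendsto (fun n : ℕ => ENNReal.ofReal (1 / ((n : ℝ) + 2))) atTop (𝓝 0) := by
      rw [← ENNReal.ofReal_zero]
      apply ENNReal.tendsto_ofReal
      exact tendsto_const_nhds.div_atTop (tendsto_natCast_atTop_atTop.atTop_add tendsto_const_nhds)
    exact le_antisymm (ge_of_tendsto' ht hle) (zero_le)
  have B : ∀ᵐ y ∂q, cdf q y < 1 := by
    rw [ae_iff]
    have hle : ∀ n : ℕ, q {y | ¬ cdf q y < 1} ≤ ENNReal.ofReal (1 / ((n : ℝ) + 2)) := by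
      intro n
      have hp : (0 : ℝ) < 1 / ((n : ℝ) + 2) := by positivity
      have hp1 : 1 / ((n : ℝ) + 2) < 1 := by
        rw [div_lt_one (by positivity)]; linarith [n.cast_nonneg (α := ℝ)]
      have := aux_cdf_le q h (u := 1 - 1 / ((n : ℝ) + 2)) (by linarith) (by linarith)
      have hms : MeasurableSet {y | cdf q y ≤ 1 - 1 / ((n : ℝ) + 2)} :=
        measurableSet_le hc.measurable measurable_const
      calc q {y | ¬ cdf q y < 1} ≤ q {y | cdf q y ≤ 1 - 1 / ((n : ℝ) + 2)}ᶜ := by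
            apply measure_mono
            intro y hy
            simp only [mem_ofPred_eq, mem_compl_iff] at hy ⊢
            linarith
        _ = ENNReal.ofReal (1 / ((n : ℝ) + 2)) := by
            rw [prob_compl_eq_one_sub hms, this, ← ENNReal.ofReal_one,
              ← ENNReal.ofReal_sub _ (by linarith)]
            congr 1; ring
    have ht : Tendsto (fun n : ℕ => ENNReal.ofReal (1 / ((n : ℝ) + 2))) atTop (𝓝 0) := by
      rw [← ENNReal.ofReal_zero]
      apply ENNReal.tendsto_ofReal
      exact tendsto_const_nhds.div_atTop (tendsto_natCast_atTop_atTop.atTop_add tendsto_const_nhds)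
    exact le_antisymm (ge_of_tendsto' ht hle) (zero_le)
  exact A.and B

lemma aux_cdf_Ioi (q : Measure ℝ) [IsProbabilityMeasure q] (t : ℝ) :
    q (Ioi t) = 1 - ENNReal.ofReal (cdf q t) := by
  rw [ofReal_cdf, ← prob_compl_eq_one_sub measurableSet_Iic, compl_Iic]

/-- Monotone transport map from an atomless law `q` to a law `p` with
continuous strictly increasing cdf. -/
lemma aux_transport (p q : Measure ℝ) [IsProbabilityMeasure p] [IsProbabilityMeasure q]
    (hp : ∀ x, p {x} = 0) (hp2 : ∀ a b, a < b → 0 < p (Ioc a b)) (hq : ∀ x, q {x} = 0) :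
    ∃ S : ℝ → ℝ, Measurable S ∧ q.map S = p ∧
      ∀ t, 0 < cdf q t → cdf q t < 1 → (Ioi t : Set ℝ) =ᵐ[q] {y | S t < S y} := by
  have hsm : StrictMono (cdf p) := by
    intro a b hab
    have h1 := hp2 a b hab
    rw [← measure_cdf p, StieltjesFunction.measure_Ioc, ENNReal.ofReal_pos] at h1
    linarith
  have hcp := aux_cdf_continuous p hp
  have hcq := aux_cdf_continuous q hq
  have hme : MeasurableEmbedding (cdf p) := hcp.measurableEmbedding hsm.injective
  have hinv : ∀ u : ℝ, 0 < u → u < 1 → cdf p (hme.invFun u) = u := by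
    intro u h0 h1
    obtain ⟨x, hx, -⟩ := aux_cdf_exists p hp h0 h1
    rw [← hx, hme.leftInverse_invFun x]
  have hp01 : ∀ x, 0 < cdf p x ∧ cdf p x < 1 := fun x =>
    ⟨(cdf_nonneg p (x - 1)).trans_lt (hsm (by linarith)),
      (hsm (by linarith : x < x + 1)).trans_le (cdf_le_one p _)⟩
  have hS : Measurable (fun y => hme.invFun (cdf q y)) := hme.measurable_invFun.comp hcq.measurable
  have hmap : q.map (fun y => hme.invFun (cdf q y)) = p := by
    have := Measure.isProbabilityMeasure_map (μ := q) hS.aemeasurable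
    apply Measure.ext_of_Iic
    intro x
    rw [Measure.map_apply hS measurableSet_Iic, ← ofReal_cdf, ← aux_cdf_le q hq (hp01 x).1 (hp01 x).2]
    apply measure_congr
    filter_upwards [aux_cdf_mem q hq] with y hy
    apply propext
    change hme.invFun (cdf q y) ≤ x ↔ cdf q y ≤ cdf p x
    rw [← hsm.le_iff_le, hinv _ hy.1 hy.2]
  refine ⟨fun y => hme.invFun (cdf q y), hS, hmap, ?_⟩
  intro t h0 h1
  have hlt : ∀ᵐ y ∂q, (hme.invFun (cdf q t) < hme.invFun (cdf q y) → t < y) := by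
    filter_upwards [aux_cdf_mem q hq] with y hy h
    rw [← hsm.lt_iff_lt, hinv _ hy.1 hy.2, hinv _ h0 h1] at h
    exact (monotone_cdf q).reflect_lt h
  have e : q {y | hme.invFun (cdf q t) < hme.invFun (cdf q y)} = p (Ioi (hme.invFun (cdf q t))) := by
    have e2 := congrArg (fun m => m (Ioi (hme.invFun (cdf q t)))) hmap
    rw [← e2, Measure.map_apply hS measurableSet_Ioi]
    rfl
  have hsub : {y | hme.invFun (cdf q t) < hme.invFun (cdf q y)} ≤ᵐ[q] (Ioi t : Set ℝ) := hlt
  have hmeas : q (Ioi t) ≤ q {y | hme.invFun (cdf q t) < hme.invFun (cdf q y)} := by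
    rw [e, aux_cdf_Ioi, aux_cdf_Ioi, hinv _ h0 h1]
  exact (ae_eq_of_ae_subset_of_measure_ge hsub hmeas
    (measurableSet_lt measurable_const hS).nullMeasurableSet (measure_ne_top _ _)).symm

lemma aux_gauss_deriv (m : ℝ) (v : ℝ≥0) (hv : v ≠ 0) (x : ℝ) :
    HasDerivAt (fun x => - (v : ℝ) * gaussianPDFReal m v x) ((x - m) * gaussianPDFReal m v x) x := by
  have hv' : (v : ℝ) ≠ 0 := by exact_mod_cast hv
  simp only [gaussianPDFReal_def]
  have h1 : HasDerivAt (fun x : ℝ => -(x - m) ^ 2 / (2 * (v : ℝ))) (-(2 * (x - m)) / (2 * v)) x := by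
    have := ((((hasDerivAt_id x).sub_const m).pow 2).neg).div_const (2 * (v : ℝ))
    simpa using this
  convert! (h1.exp.const_mul ((√(2 * π * v))⁻¹)).const_mul (-(v : ℝ)) using 1
  field_simp

open Filter Topology in
lemma aux_gauss_tail (m : ℝ) (v : ℝ≥0) (hv : v ≠ 0) (a : ℝ) :
    ∫ x in Ioi a, (x - m) ∂(gaussianReal m v) = v * gaussianPDFReal m v a := by
  have hv' : (v : ℝ) ≠ 0 := by exact_mod_cast hv
  have hv0 : 0 < (v : ℝ) := by positivity
  have hint : Integrable (fun x => x - m) (gaussianReal m v) :=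
    ((memLp_id_gaussianReal (μ := m) (v := v) 1).integrable (by simp)).sub (integrable_const m)
  have hint2 : Integrable (fun x => (x - m) * gaussianPDFReal m v x) := by
    rw [gaussianReal_of_var_ne_zero m hv] at hint
    rw [integrable_withDensity_iff (measurable_gaussianPDF m v)
      (Filter.Eventually.of_forall fun x => gaussianPDF_lt_top)] at hint
    simpa [toReal_gaussianPDF] using hint
  rw [← integral_indicator measurableSet_Ioi, integral_gaussianReal_eq_integral_smul hv]
  have : (fun x => gaussianPDFReal m v x • (Ioi a).indicator (fun x => x - m) x) =
      (Ioi a).indicator (fun x => (x - m) * gaussianPDFReal m v x) := by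
    ext x
    by_cases hx : x ∈ Ioi a <;> simp [hx, mul_comm]
  rw [this, integral_indicator measurableSet_Ioi]
  have hlim : Tendsto (fun x => - (v : ℝ) * gaussianPDFReal m v x) atTop (𝓝 0) := by
    have : Tendsto (fun x => gaussianPDFReal m v x) atTop (𝓝 0) := by
      simp only [gaussianPDFReal_def]
      rw [← mul_zero ((√(2 * π * v))⁻¹)]
      apply Tendsto.const_mul
      apply Real.tendsto_exp_atBot.comp
      have h2 : Tendsto (fun x : ℝ => (x - m) ^ 2 / (2 * (v : ℝ))) atTop atTop := by
        apply Tendsto.atTop_div_const (by positivity)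
        exact (tendsto_pow_atTop two_ne_zero).comp (tendsto_atTop_add_const_right _ (-m) tendsto_id)
      convert! tendsto_neg_atTop_atBot.comp h2 using 1
      ext x
      simp [neg_div]
    simpa using this.const_mul (-(v : ℝ))
  rw [integral_Ioi_of_hasDerivAt_of_tendsto' (fun x _ => aux_gauss_deriv m v hv x)
    hint2.integrableOn hlim]
  ring

lemma aux_fubini (q : Measure ℝ) [IsProbabilityMeasure q] (m : ℝ) (Z : ℝ → ℝ) (hZ : Measurable Z)
    (hZi : Integrable Z q) (hZ0 : ∫ y, Z y ∂q = 0) (hZy : Integrable (fun y => Z y * (y - m)) q) :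
    Integrable (fun t => ∫ y in Ioi t, Z y ∂q) ∧
      ∫ t, (∫ y in Ioi t, Z y ∂q) = ∫ y, Z y * (y - m) ∂q := by
  let k : ℝ → ℝ → ℝ := fun y t =>
    (Ico m y).indicator (fun _ => (1 : ℝ)) t - (Ico y m).indicator (fun _ => (1 : ℝ)) t
  have hkm : Measurable (Function.uncurry k) := by
    have e : Function.uncurry k = fun z : ℝ × ℝ =>
        {z : ℝ × ℝ | m ≤ z.2 ∧ z.2 < z.1}.indicator (fun _ => (1 : ℝ)) z
          - {z : ℝ × ℝ | z.1 ≤ z.2 ∧ z.2 < m}.indicator (fun _ => (1 : ℝ)) z := by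
      ext ⟨y, t⟩
      simp [k, Function.uncurry, indicator]
    rw [e]
    apply Measurable.sub
    · exact measurable_const.indicator ((measurableSet_le measurable_const measurable_snd).inter
        (measurableSet_lt measurable_snd measurable_fst))
    · exact measurable_const.indicator ((measurableSet_le measurable_fst measurable_snd).inter
        (measurableSet_lt measurable_snd measurable_const))
  have hI : ∀ a b : ℝ, Integrable ((Ico a b).indicator (fun _ => (1 : ℝ))) := fun a b => by
    rw [integrable_indicator_iff measurableSet_Ico]
    exact integrableOn_const (by simp)
  have hIi : ∀ a b : ℝ, ∫ t, (Ico a b).indicator (fun _ => (1 : ℝ)) t = max (b - a) 0 := fun a b => by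
    rw [integral_indicator measurableSet_Ico]
    simp
  have hki : ∀ y, Integrable (k y) := fun y => (hI m y).sub (hI y m)
  have hkint : ∀ y, ∫ t, k y t = y - m := by
    intro y
    simp only [k]
    rw [integral_sub (hI m y) (hI y m), hIi, hIi]
    rcases le_total y m with h | h
    · rw [max_eq_right (by linarith), max_eq_left (by linarith)]; ring
    · rw [max_eq_left (by linarith), max_eq_right (by linarith)]; ring
  have hkabs : ∀ y, ∫ t, |k y t| = |y - m| := by
    intro y
    have e : ∀ t, |k y t| = (Ico m y).indicator (fun _ => (1 : ℝ)) t +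
        (Ico y m).indicator (fun _ => (1 : ℝ)) t := by
      intro t
      rcases le_total y m with h | h
      · have : Ico m y = ∅ := Ico_eq_empty (by linarith)
        simp only [k, this, indicator_empty, zero_sub, abs_neg, zero_add]
        exact abs_of_nonneg (indicator_nonneg (fun _ _ => zero_le_one) _)
      · have : Ico y m = ∅ := Ico_eq_empty (by linarith)
        simp only [k, this, indicator_empty, sub_zero, add_zero]
        exact abs_of_nonneg (indicator_nonneg (fun _ _ => zero_le_one) _)
    simp only [e]
    rw [integral_add (hI m y) (hI y m), hIi, hIi]
    rcases le_total y m with h | h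
    · rw [max_eq_right (by linarith), max_eq_left (by linarith), abs_of_nonpos (by linarith)]; ring
    · rw [max_eq_left (by linarith), max_eq_right (by linarith), abs_of_nonneg (by linarith)]; ring
  have hint : Integrable (Function.uncurry fun y t => Z y * k y t) (q.prod volume) := by
    have hmeas : Measurable (Function.uncurry fun y t => Z y * k y t) :=
      (hZ.comp measurable_fst).mul hkm
    rw [integrable_prod_iff hmeas.aestronglyMeasurable]
    constructor
    · exact Filter.Eventually.of_forall fun y => (hki y).const_mul (Z y)
    · have : (fun y => ∫ t, ‖(Function.uncurry fun y t => Z y * k y t) (y, t)‖) =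
          fun y => ‖Z y * (y - m)‖ := by
        ext y
        simp only [Function.uncurry, norm_mul, norm_eq_abs]
        rw [integral_const_mul, hkabs]
      rw [this]
      exact hZy.norm
  have hA : ∀ t, ∫ y, Z y * k y t ∂q = ∫ y in Ioi t, Z y ∂q := by
    intro t
    have e : ∀ y, Z y * k y t = (Ioi t).indicator Z y - (if t < m then 1 else 0) * Z y := by
      intro y
      simp only [k, indicator, mem_Ico, mem_Ioi]
      by_cases h1 : t < m <;> by_cases h2 : t < y <;>
        simp [h1, h2, not_le.mpr, not_lt.mp]
    simp only [e]
    rw [integral_sub (hZi.indicator measurableSet_Ioi) (hZi.const_mul _), integral_const_mul, hZ0,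
      integral_indicator measurableSet_Ioi]
    simp
  constructor
  · have := hint.integral_prod_right
    simp only [Function.uncurry] at this
    simpa only [hA] using this
  · have := integral_integral_swap hint
    simp only [hA, integral_const_mul, hkint] at this
    exact this.symm

lemma aux_gauss_sq (m : ℝ) (v : ℝ≥0) :
    Integrable (fun x => (x - m) ^ 2) (gaussianReal m v) ∧
      ∫ x, (x - m) ^ 2 ∂(gaussianReal m v) = v := by
  constructor
  · have h : MemLp (fun x : ℝ => x - m) 2 (gaussianReal m v) :=
      (memLp_id_gaussianReal (μ := m) (v := v) 2).sub (memLp_const m)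
    exact h.integrable_sq
  · have h := variance_fun_id_gaussianReal (μ := m) (v := v)
    rw [variance_eq_integral (by fun_prop), integral_id_gaussianReal] at h
    exact h

lemma aux_gauss_Ioc (m : ℝ) (v : ℝ≥0) (hv : v ≠ 0) (a b : ℝ) (hab : a < b) :
    0 < gaussianReal m v (Ioc a b) := by
  rw [pos_iff_ne_zero]
  intro h
  have := gaussianReal_absolutelyContinuous' m hv h
  simp at this
  linarith

lemma aux_key (m : ℝ) (v : ℝ≥0) (hv : v ≠ 0) (q : Measure ℝ) [IsProbabilityMeasure q]
    (hm2 : Integrable (fun x => (x - m) ^ 2) q) (hac : q ≪ gaussianReal m v)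
    (hlog : Integrable (fun x => Real.log (q.rnDeriv (gaussianReal m v) x).toReal) q) :
    ∃ S : ℝ → ℝ, Measurable S ∧ q.map S = gaussianReal m v ∧
      Integrable (fun y => (S y - m) * (y - m)) q ∧
      v * Real.exp (-(∫ x, Real.log (q.rnDeriv (gaussianReal m v) x).toReal ∂q)
        - 1 / 2 + (∫ x, (x - m) ^ 2 ∂q) / (2 * v)) ≤ ∫ y, (S y - m) * (y - m) ∂q := by
  have hv' : (v : ℝ) ≠ 0 := by exact_mod_cast hv
  have hv0 : 0 < (v : ℝ) := by positivity
  set p := gaussianReal m v with hp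
  have hpa : ∀ x, p {x} = 0 := fun x =>
    gaussianReal_absolutelyContinuous m hv (by simp)
  obtain ⟨S, hS, hmap, hSt⟩ := aux_transport p q hpa (aux_gauss_Ioc m v hv) (fun x => hac (hpa x))
  -- moments of S
  have hSsq : Integrable (fun y => (S y - m) ^ 2) q := by
    have := (aux_gauss_sq m v).1
    rw [← hp, ← hmap, integrable_map_measure (by fun_prop) hS.aemeasurable] at this
    exact this
  have hSsqi : ∫ y, (S y - m) ^ 2 ∂q = v := by
    have := (aux_gauss_sq m v).2
    rw [← hp, ← hmap, integral_map hS.aemeasurable (by fun_prop)] at this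
    exact this
  have hSi : Integrable (fun y => S y - m) q := by
    have : MemLp (fun y => S y - m) 2 q :=
      (memLp_two_iff_integrable_sq (by fun_prop)).2 hSsq
    exact this.integrable (by simp)
  have hZ0 : ∫ y, (S y - m) ∂q = 0 := by
    have h1 : ∫ x, (x - m) ∂p = 0 := by
      have hid : Integrable (fun x : ℝ => x) p :=
        (memLp_id_gaussianReal (μ := m) (v := v) 1).integrable (by simp)
      rw [integral_sub hid (integrable_const m), hp, integral_id_gaussianReal]
      simp
    rw [← hmap, integral_map hS.aemeasurable (by fun_prop)] at h1
    exact h1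
  have hZy : Integrable (fun y => (S y - m) * (y - m)) q :=
    MemLp.integrable_mul (p := 2) (q := 2) ((memLp_two_iff_integrable_sq (by fun_prop)).2 hSsq)
      ((memLp_two_iff_integrable_sq (by fun_prop)).2 hm2)
  refine ⟨S, hS, hmap, hZy, ?_⟩
  obtain ⟨hAi, hAint⟩ := aux_fubini q m (fun y => S y - m) (by fun_prop) hSi hZ0 hZy
  set A : ℝ → ℝ := fun t => ∫ y in Ioi t, (S y - m) ∂q with hA
  have hAeq : ∀ t, 0 < cdf q t → cdf q t < 1 → A t = v * gaussianPDFReal m v (S t) := by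
    intro t h0 h1
    rw [← aux_gauss_tail m v hv (S t), ← hp, ← hmap,
      setIntegral_map measurableSet_Ioi (by fun_prop) hS.aemeasurable, hA]
    exact setIntegral_congr_set (hSt t h0 h1)
  have hA0 : ∀ t, 0 ≤ A t := by
    intro t
    by_cases h0 : 0 < cdf q t
    · by_cases h1 : cdf q t < 1
      · rw [hAeq t h0 h1]
        exact mul_nonneg hv0.le (gaussianPDFReal_nonneg _ _ _)
      · have : q (Ioi t) = 0 := by
          rw [aux_cdf_Ioi, le_antisymm (cdf_le_one q t) (not_lt.1 h1)]; simp
        simp only [hA]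
        rw [setIntegral_measure_zero _ this]
    · have : q (Iic t) = 0 := by
        rw [← ofReal_cdf]; exact ENNReal.ofReal_eq_zero.2 (not_lt.1 h0)
      have h2 := integral_add_compl (s := Iic t) measurableSet_Iic hSi
      rw [setIntegral_measure_zero _ this, hZ0, compl_Iic, zero_add] at h2
      exact h2.ge
  set r : ℝ → ℝ≥0∞ := q.rnDeriv p with hr
  have hrm : Measurable r := Measure.measurable_rnDeriv q p
  set D := ∫ x, Real.log (r x).toReal ∂q with hD
  let g : ℝ → ℝ := fun y => -(S y - m) ^ 2 / (2 * v) + (y - m) ^ 2 / (2 * v) - Real.log (r y).toReal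
  have hg1 : Integrable (fun y => -(S y - m) ^ 2 / (2 * (v : ℝ))) q := hSsq.neg.div_const _
  have hg2 : Integrable (fun y => (y - m) ^ 2 / (2 * (v : ℝ))) q := hm2.div_const _
  have hgi : Integrable g q := (hg1.add hg2).sub hlog
  have hgint : ∫ y, g y ∂q = -D - 1 / 2 + (∫ x, (x - m) ^ 2 ∂q) / (2 * v) := by
    simp only [g]
    have hg12 : Integrable (fun y => -(S y - m) ^ 2 / (2 * (v : ℝ)) + (y - m) ^ 2 / (2 * (v : ℝ))) q :=
      hg1.add hg2
    rw [integral_sub hg12 hlog, integral_add hg1 hg2, integral_div, integral_div,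
      integral_neg, hSsqi]
    field_simp
    ring
  have hAm : AEMeasurable A := hAi.aestronglyMeasurable.aemeasurable
  have hgm : AEMeasurable g q := hgi.aestronglyMeasurable.aemeasurable
  have hexp : ∀ᵐ y ∂q, Real.exp (g y) = A y / (v * gaussianPDFReal m v y * (r y).toReal) := by
    filter_upwards [aux_cdf_mem q (fun x => hac (hpa x)), Measure.rnDeriv_pos hac,
      hac.ae_le (Measure.rnDeriv_lt_top q p)] with y hy hpos hlt
    have hrpos : 0 < (r y).toReal := ENNReal.toReal_pos hpos.ne' hlt.ne
    rw [hAeq y hy.1 hy.2]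
    simp only [g, gaussianPDFReal_def]
    rw [Real.exp_sub, Real.exp_add, Real.exp_log hrpos]
    have hsq : 0 < √(2 * π * v) := by positivity
    rw [show (y - m) ^ 2 / (2 * (v : ℝ)) = -(-(y - m) ^ 2 / (2 * (v : ℝ))) by ring, Real.exp_neg]
    field_simp
  -- comparison with Lebesgue
  have hlint : ∫⁻ y, ENNReal.ofReal (Real.exp (g y)) ∂q ≤ ∫⁻ t, ENNReal.ofReal (A t / v) := by
    have hqd : q = volume.withDensity (gaussianPDF m v * r) := by
      have h1 : p.withDensity r = q := Measure.withDensity_rnDeriv_eq q p hac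
      rw [hp, gaussianReal_of_var_ne_zero m hv,
        ← withDensity_mul _ (measurable_gaussianPDF m v) hrm] at h1
      exact h1.symm
    calc ∫⁻ y, ENNReal.ofReal (Real.exp (g y)) ∂q
        = ∫⁻ y, ENNReal.ofReal (A y / (v * gaussianPDFReal m v y * (r y).toReal)) ∂q := by
          apply lintegral_congr_ae
          filter_upwards [hexp] with y hy
          rw [hy]
      _ = ∫⁻ y, (gaussianPDF m v y * r y) *
            ENNReal.ofReal (A y / (v * gaussianPDFReal m v y * (r y).toReal)) := by
          conv_lhs => rw [hqd]
          rw [lintegral_withDensity_eq_lintegral_mul₀ ((measurable_gaussianPDF m v).mul hrm).aemeasurable]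
          · rfl
          · refine (hAm.div (AEMeasurable.mul ?_ hrm.ennreal_toReal.aemeasurable)).ennreal_ofReal
            exact ((measurable_gaussianPDFReal m v).const_mul _).aemeasurable
      _ ≤ ∫⁻ t, ENNReal.ofReal (A t / v) := by
          apply lintegral_mono
          intro y
          have hpd := gaussianPDFReal_pos m v y hv
          by_cases h : (r y).toReal = 0
          · simp [h]
          · have hrt : r y ≠ ⊤ := by
              intro hrtop; simp [hrtop] at h
            have hr0 : 0 < (r y).toReal := lt_of_le_of_ne ENNReal.toReal_nonneg (Ne.symm h)
            simp only
            rw [gaussianPDF, ← ENNReal.ofReal_toReal hrt, ← ENNReal.ofReal_mul hpd.le,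
              ← ENNReal.ofReal_mul (by positivity), ENNReal.toReal_ofReal hr0.le]
            apply ENNReal.ofReal_le_ofReal
            apply le_of_eq
            field_simp
  have hAvi : Integrable (fun t => A t / v) := hAi.div_const _
  have hexpi : Integrable (fun y => Real.exp (g y)) q := by
    refine ⟨(Real.measurable_exp.comp_aemeasurable hgm).aestronglyMeasurable, ?_⟩
    rw [hasFiniteIntegral_iff_ofReal (Filter.Eventually.of_forall fun y => (Real.exp_pos _).le)]
    refine hlint.trans_lt ?_
    rw [← hasFiniteIntegral_iff_ofReal
      (Filter.Eventually.of_forall fun t => div_nonneg (hA0 t) hv0.le)]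
    exact hAvi.2
  have hle : ∫ y, Real.exp (g y) ∂q ≤ (∫ t, A t) / v := by
    rw [← integral_div]
    rw [← ofReal_integral_eq_lintegral_ofReal hexpi
        (Filter.Eventually.of_forall fun y => (Real.exp_pos _).le),
      ← ofReal_integral_eq_lintegral_ofReal hAvi
        (Filter.Eventually.of_forall fun t => div_nonneg (hA0 t) hv0.le)] at hlint
    exact (ENNReal.ofReal_le_ofReal_iff
      (integral_nonneg fun t => div_nonneg (hA0 t) hv0.le)).1 hlint
  have hjensen : Real.exp (∫ y, g y ∂q) ≤ ∫ y, Real.exp (g y) ∂q := by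
    have h1 : ∀ y, Real.exp (∫ y, g y ∂q) * (1 + (g y - ∫ y, g y ∂q)) ≤ Real.exp (g y) := by
      intro y
      have := Real.add_one_le_exp (g y - ∫ y, g y ∂q)
      calc Real.exp (∫ y, g y ∂q) * (1 + (g y - ∫ y, g y ∂q))
          ≤ Real.exp (∫ y, g y ∂q) * Real.exp (g y - ∫ y, g y ∂q) := by
            apply mul_le_mul_of_nonneg_left (by linarith) (Real.exp_pos _).le
        _ = Real.exp (g y) := by rw [← Real.exp_add]; congr 1; ring
    have hi2 : Integrable (fun y => g y - ∫ y, g y ∂q) q := hgi.sub (integrable_const _)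
    have h2 := integral_mono (((integrable_const (1 : ℝ)).add hi2).const_mul
      (Real.exp (∫ y, g y ∂q))) hexpi h1
    rw [integral_const_mul] at h2
    have h3 : ∫ y, (1 + (g y - ∫ y, g y ∂q)) ∂q = 1 := by
      rw [integral_add (integrable_const _) hi2, integral_sub hgi (integrable_const _)]
      simp
    simp only [Pi.add_apply] at h2
    rw [h3, mul_one] at h2
    exact h2
  rw [← hgint, ← hAint]
  have := hjensen.trans hle
  rw [le_div_iff₀ hv0] at this
  linarith

lemma aux_prod (m : ℝ) (v : ℝ≥0) (q : Measure ℝ) [IsProbabilityMeasure q]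
    (hm2 : Integrable (fun x => (x - m) ^ 2) q) (hmean : ∫ x, (x - m) ∂q = 0) :
    W2sq (gaussianReal m v) q ≤ ENNReal.ofReal (v + ∫ x, (x - m) ^ 2 ∂q) := by
  unfold W2sq
  refine iInf_le_of_le ((gaussianReal m v).prod q) (iInf_le_of_le inferInstance
    (iInf_le_of_le (by simp [Measure.map_fst_prod]) (iInf_le_of_le (by simp [Measure.map_snd_prod]) ?_)))
  have hq1 : Integrable (fun y => y - m) q :=
    ((memLp_two_iff_integrable_sq (by fun_prop)).2 hm2).integrable (by simp)
  have hp1 : Integrable (fun y => y - m) (gaussianReal m v) :=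
    ((memLp_two_iff_integrable_sq (by fun_prop)).2 (aux_gauss_sq m v).1).integrable (by simp)
  have i1 : Integrable (fun z : ℝ × ℝ => (z.1 - m) ^ 2) ((gaussianReal m v).prod q) :=
    (aux_gauss_sq m v).1.comp_fst q
  have i2 : Integrable (fun z : ℝ × ℝ => (z.2 - m) ^ 2) ((gaussianReal m v).prod q) :=
    hm2.comp_snd (gaussianReal m v)
  have i3 : Integrable (fun z : ℝ × ℝ => (z.1 - m) * (z.2 - m)) ((gaussianReal m v).prod q) :=
    hp1.mul_prod hq1
  have i12 : Integrable (fun z : ℝ × ℝ => (z.1 - m) ^ 2 + (z.2 - m) ^ 2) ((gaussianReal m v).prod q) :=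
    i1.add i2
  have e : ∀ z : ℝ × ℝ, (z.1 - z.2) ^ 2 =
      (z.1 - m) ^ 2 + (z.2 - m) ^ 2 - 2 * ((z.1 - m) * (z.2 - m)) := fun z => by ring
  have hi : Integrable (fun z : ℝ × ℝ => (z.1 - z.2) ^ 2) ((gaussianReal m v).prod q) := by
    simp only [e]
    exact i12.sub (i3.const_mul 2)
  rw [← ofReal_integral_eq_lintegral_ofReal hi (Filter.Eventually.of_forall fun z => sq_nonneg _)]
  apply ENNReal.ofReal_le_ofReal
  apply le_of_eq
  simp only [e]
  rw [integral_sub i12 (i3.const_mul 2), integral_add i1 i2, integral_const_mul,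
    integral_prod_mul (fun x => x - m) (fun x => x - m), hmean,
    integral_fun_fst (fun x => (x - m) ^ 2), integral_fun_snd (fun x => (x - m) ^ 2),
    (aux_gauss_sq m v).2]
  simp

lemma aux_map (m : ℝ) (v : ℝ≥0) (q : Measure ℝ) [IsProbabilityMeasure q]
    (hm2 : Integrable (fun x => (x - m) ^ 2) q) (S : ℝ → ℝ) (hS : Measurable S)
    (hmap : q.map S = gaussianReal m v) (hZy : Integrable (fun y => (S y - m) * (y - m)) q) :
    W2sq (gaussianReal m v) q ≤
      ENNReal.ofReal (v + ∫ x, (x - m) ^ 2 ∂q - 2 * ∫ y, (S y - m) * (y - m) ∂q) := by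
  have hSm : Measurable (fun y => (S y, y)) := hS.prodMk measurable_id
  unfold W2sq
  refine iInf_le_of_le (q.map (fun y => (S y, y))) (iInf_le_of_le
    (Measure.isProbabilityMeasure_map hSm.aemeasurable)
    (iInf_le_of_le ?_ (iInf_le_of_le ?_ ?_)))
  · rw [Measure.map_map measurable_fst hSm, ← hmap]; rfl
  · rw [Measure.map_map measurable_snd hSm]
    exact Measure.map_id
  have hSsq : Integrable (fun y => (S y - m) ^ 2) q := by
    have := (aux_gauss_sq m v).1
    rw [← hmap, integrable_map_measure (by fun_prop) hS.aemeasurable] at this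
    exact this
  have hSsqi : ∫ y, (S y - m) ^ 2 ∂q = v := by
    have := (aux_gauss_sq m v).2
    rw [← hmap, integral_map hS.aemeasurable (by fun_prop)] at this
    exact this
  have i12 : Integrable (fun y => (S y - m) ^ 2 + (y - m) ^ 2) q := hSsq.add hm2
  have e : ∀ y, (S y - y) ^ 2 =
      (S y - m) ^ 2 + (y - m) ^ 2 - 2 * ((S y - m) * (y - m)) := fun z => by ring
  have hi : Integrable (fun y => (S y - y) ^ 2) q := by
    simp only [e]
    exact i12.sub (hZy.const_mul 2)
  rw [lintegral_map (by fun_prop) hSm,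
    ← ofReal_integral_eq_lintegral_ofReal hi (Filter.Eventually.of_forall fun z => sq_nonneg _)]
  apply ENNReal.ofReal_le_ofReal
  apply le_of_eq
  simp only [e]
  rw [integral_sub i12 (hZy.const_mul 2), integral_add hSsq hm2, integral_const_mul, hSsqi]

/-- Refined Talagrand transportation inequality. -/
theorem stmt4 (μX σX : ℝ) (hσX : 0 < σX) (q : Measure ℝ) (hq : IsProbabilityMeasure q)
    (hm2 : Integrable (fun x => x ^ 2) q) (hmean : ∫ x, x ∂q = μX)
    (σhat : ℝ) (hσhat : 0 ≤ σhat) (hvar : ∫ x, (x - μX) ^ 2 ∂q = σhat ^ 2)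
    (hle : σhat ≤ σX) :
    W2sq (gauss μX σX) q ≤
      ENNReal.ofReal (2 * σX ^ 2 * (1 - expNeg (KLD q (gauss μX σX)))) := by
  have hL2 : MemLp (fun x : ℝ => x) 2 q := (memLp_two_iff_integrable_sq (by fun_prop)).2 hm2
  have hm2' : Integrable (fun x => (x - μX) ^ 2) q := (hL2.sub (memLp_const μX)).integrable_sq
  have hmean' : ∫ x, (x - μX) ∂q = 0 := by
    rw [integral_sub (hL2.integrable (by simp)) (integrable_const _), hmean]
    simp
  have hsq : σhat ^ 2 ≤ σX ^ 2 := pow_le_pow_left₀ hσhat hle 2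
  unfold gauss
  set v : ℝ≥0 := ⟨σX ^ 2, sq_nonneg σX⟩ with hvdef
  have hvv : (v : ℝ) = σX ^ 2 := rfl
  have hv0 : 0 < (v : ℝ) := by rw [hvv]; positivity
  have hv : v ≠ 0 := by
    intro h; rw [h] at hv0; simp at hv0
  by_cases hKL : q ≪ gaussianReal μX v ∧
      Integrable (fun x => Real.log (q.rnDeriv (gaussianReal μX v) x).toReal) q
  · obtain ⟨S, hS, hmap, hZy, hkey⟩ := aux_key μX v hv q hm2' hKL.1 hKL.2
    refine (aux_map μX v q hm2' S hS hmap hZy).trans (ENNReal.ofReal_le_ofReal ?_)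
    rw [hvar] at hkey ⊢
    unfold KLD
    rw [if_pos hKL]
    set D := ∫ x, Real.log (q.rnDeriv (gaussianReal μX v) x).toReal ∂q with hD
    simp only [expNeg, ENNReal.ofReal_ne_top, if_false, ENNReal.toReal_ofReal']
    have hD1 : D ≤ max D 0 := le_max_left _ _
    have hD2 : 0 ≤ max D 0 := le_max_right _ _
    set D' := max D 0
    have hE1 : Real.exp (-D') ≤ 1 := Real.exp_le_one_iff.2 (by linarith)
    have hE0 := Real.exp_pos (-D')
    set w : ℝ := 1 / 2 - σhat ^ 2 / (2 * v) with hw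
    have hw0 : 0 ≤ w := by
      rw [hw, sub_nonneg, div_le_div_iff₀ (by positivity) (by norm_num), hvv]
      linarith
    have hwv : 2 * v * w = v - σhat ^ 2 := by
      rw [hw]; field_simp
    have h1 : v * (Real.exp (-D') * Real.exp (-w)) ≤ ∫ y, (S y - μX) * (y - μX) ∂q := by
      refine le_trans ?_ hkey
      rw [← Real.exp_add]
      apply mul_le_mul_of_nonneg_left _ hv0.le
      apply Real.exp_le_exp.2
      rw [hw]; linarith
    have h2 : 1 - w ≤ Real.exp (-w) := by have := Real.add_one_le_exp (-w); linarith
    have h3 : Real.exp (-D') * (1 - Real.exp (-w)) ≤ w := by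
      nlinarith
    rw [← hvv]
    nlinarith
  · have hb := aux_prod μX v q hm2' hmean'
    refine hb.trans (ENNReal.ofReal_le_ofReal ?_)
    unfold KLD
    rw [if_neg hKL, hvar]
    simp only [expNeg, if_true, hvv]
    linarith
end
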